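/- arXiv:2605.06172 — 4 statements merged into one kernel-verified Lean document; each statement's English description precedes it below -/
import Mathlib

section
/- Let p_H be a probability density on ℝ^n with finite second moment ∫_{ℝ^n} ‖x‖² p_H(x) dx < ∞, and let p_t be its VP marginals. Then the Kullback–Leibler divergence KL(p_t·λ ‖ γ_n) tends to 0 as t → ∞. -/
open MeasureTheory Real Filter Set
open scoped ENNReal Topology RealInnerProductSpace Classical

noncomputable section

/-- Gaussian density kernel with covariance `s2 • I`. -/
def gaussKernel (n : ℕ) (s2 : ℝ) (z : EuclideanSpace ℝ (Fin n)) : ℝ :=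
  (2 * π * s2) ^ (-(n : ℝ) / 2) * Real.exp (-‖z‖ ^ 2 / (2 * s2))

/-- VP diffusion marginal `p_t`, with `p_0 = p_H`. -/
def vpMarginal (n : ℕ) (pH : EuclideanSpace ℝ (Fin n) → ℝ) (t : ℝ)
    (x : EuclideanSpace ℝ (Fin n)) : ℝ :=
  if t = 0 then pH x
  else ∫ y, pH y * gaussKernel n (1 - Real.exp (-t)) (x - Real.exp (-t / 2) • y)

/-- The measure with Lebesgue density `p`. -/
def densMeasure (n : ℕ) (p : EuclideanSpace ℝ (Fin n) → ℝ) :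
    Measure (EuclideanSpace ℝ (Fin n)) :=
  volume.withDensity fun x => ENNReal.ofReal (p x)

/-- The standard Gaussian measure `γ_n`. -/
def stdGaussian (n : ℕ) : Measure (EuclideanSpace ℝ (Fin n)) :=
  densMeasure n (gaussKernel n 1)

/-- Score function `s_t = ∇ log p_t`. -/
def score (n : ℕ) (pH : EuclideanSpace ℝ (Fin n) → ℝ) (t : ℝ)
    (x : EuclideanSpace ℝ (Fin n)) : EuclideanSpace ℝ (Fin n) :=
  gradient (fun z => Real.log (vpMarginal n pH t z)) x

/-- Probability-flow vector field `v_t(x) = -x/2 - s_t(x)/2`. -/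
def vField (n : ℕ) (pH : EuclideanSpace ℝ (Fin n) → ℝ) (t : ℝ)
    (x : EuclideanSpace ℝ (Fin n)) : EuclideanSpace ℝ (Fin n) :=
  -(2 : ℝ)⁻¹ • x - (2 : ℝ)⁻¹ • score n pH t x

/-- `φ` is a flow map of `v` from time `s` to time `T`. -/
def IsFlowMap (n : ℕ)
    (v : ℝ → EuclideanSpace ℝ (Fin n) → EuclideanSpace ℝ (Fin n)) (s T : ℝ)
    (φ : EuclideanSpace ℝ (Fin n) → EuclideanSpace ℝ (Fin n)) : Prop :=
  ∀ x, ∃ γ : ℝ → EuclideanSpace ℝ (Fin n),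
    γ s = x ∧ (∀ t ∈ Set.Icc s T, HasDerivAt γ (v t (γ t)) t) ∧ γ T = φ x

/-- Total variation norm `‖μ - ν‖_TV` of the difference of two finite measures. -/
def tvDist {α : Type*} [MeasurableSpace α] (μ ν : Measure α) : ℝ≥0∞ :=
  (⨆ (s : Set α) (_ : MeasurableSet s), μ s - ν s) +
    (⨆ (s : Set α) (_ : MeasurableSet s), ν s - μ s)

/-- Kullback–Leibler divergence. -/
def klDiv {α : Type*} [MeasurableSpace α] (μ ν : Measure α) : ℝ≥0∞ :=
  if μ ≪ ν ∧ Integrable (llr μ ν) μ then ENNReal.ofReal (∫ x, llr μ ν x ∂μ) else ⊤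

/-- A real function is twice differentiable. -/
def TwiceDiff {E : Type*} [NormedAddCommGroup E] [NormedSpace ℝ E] (f : E → ℝ) : Prop :=
  Differentiable ℝ f ∧ Differentiable ℝ (fderiv ℝ f)

/-- Hessian of a real function as a continuous bilinear map. -/
def hessian {E : Type*} [NormedAddCommGroup E] [NormedSpace ℝ E] (f : E → ℝ) (x : E) :
    E →L[ℝ] E →L[ℝ] ℝ :=
  fderiv ℝ (fderiv ℝ f) x

/-- A map is bi-Lipschitz. -/
def BiLipschitz {E : Type*} [NormedAddCommGroup E] (φ : E → E) : Prop :=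
  ∃ c C : ℝ, 0 < c ∧ c ≤ C ∧
    ∀ x y, c * ‖x - y‖ ≤ ‖φ x - φ y‖ ∧ ‖φ x - φ y‖ ≤ C * ‖x - y‖

/-- Centered Gaussian density with covariance matrix `S`. -/
def gaussMat (n : ℕ) (S : Matrix (Fin n) (Fin n) ℝ) (z : EuclideanSpace ℝ (Fin n)) : ℝ :=
  ((2 * π) ^ n * S.det) ^ (-(1 : ℝ) / 2) *
    Real.exp (-(∑ i, z i * S⁻¹.mulVec (fun j => z j) i) / 2)

end

section Helpers

open InformationTheory (klFun)

variable {n : ℕ}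

lemma gk_pos {s : ℝ} (hs : 0 < s) (z : EuclideanSpace ℝ (Fin n)) : 0 < gaussKernel n s z := by
  unfold gaussKernel; positivity

lemma gk_cont (s : ℝ) : Continuous (gaussKernel n s) := by
  unfold gaussKernel; fun_prop

lemma gk_integral {s : ℝ} (hs : 0 < s) : ∫ z, gaussKernel n s z = 1 := by
  have h := GaussianFourier.integral_rexp_neg_mul_sq_norm (V := EuclideanSpace ℝ (Fin n))
    (b := 1 / (2 * s)) (by positivity)
  unfold gaussKernel
  rw [integral_const_mul]
  have e : ∀ z : EuclideanSpace ℝ (Fin n), -‖z‖ ^ 2 / (2 * s) = -(1 / (2 * s)) * ‖z‖ ^ 2 := by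
    intro z; ring
  simp_rw [e]
  rw [h, finrank_euclideanSpace_fin]
  have e2 : π / (1 / (2 * s)) = 2 * π * s := by field_simp
  rw [e2, ← Real.rpow_add (by positivity)]
  have : -(n : ℝ) / 2 + n / 2 = 0 := by ring
  rw [this, Real.rpow_zero]

lemma gk_integrable {s : ℝ} (hs : 0 < s) : Integrable (gaussKernel n s) := by
  by_contra h
  have := integral_undef h
  rw [gk_integral hs] at this
  exact one_ne_zero this

lemma gk_lintegral {s : ℝ} (hs : 0 < s) : ∫⁻ z, ENNReal.ofReal (gaussKernel n s z) = 1 := by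
  rw [← ofReal_integral_eq_lintegral_ofReal (gk_integrable hs)
    (ae_of_all _ fun z => (gk_pos hs z).le), gk_integral hs, ENNReal.ofReal_one]

lemma gk_inner_integrable {s : ℝ} (hs : 0 < s) (v : EuclideanSpace ℝ (Fin n)) :
    Integrable (fun w => gaussKernel n s w * ⟪w, v⟫) := by
  have h2 := ((gk_integrable (n := n) (s := 2 * s) (by positivity)).const_mul
    ((2 * π * s) ^ (-(n : ℝ) / 2) / (2 * π * (2 * s)) ^ (-(n : ℝ) / 2) * ((1 + 4 * s) * ‖v‖)))
  refine h2.mono' ((gk_cont s).mul (by fun_prop)).aestronglyMeasurable (ae_of_all _ fun w => ?_)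
  rw [norm_mul, Real.norm_of_nonneg (gk_pos hs w).le]
  have h3 : ‖⟪w, v⟫‖ ≤ ‖w‖ * ‖v‖ := norm_inner_le_norm w v
  have h4 : ‖w‖ ≤ (1 + 4 * s) * Real.exp (‖w‖ ^ 2 / (4 * s)) := by
    have h5 := Real.add_one_le_exp (‖w‖ ^ 2 / (4 * s))
    have h6 : ‖w‖ ≤ (1 + 4 * s) * (‖w‖ ^ 2 / (4 * s) + 1) := by
      have : (1 + 4 * s) * (‖w‖ ^ 2 / (4 * s) + 1) = ‖w‖ ^ 2 / (4 * s) + 1 + ‖w‖ ^ 2 + 4 * s := by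
        field_simp; ring
      rw [this]
      have : 0 ≤ ‖w‖ ^ 2 / (4 * s) := by positivity
      nlinarith [sq_nonneg (‖w‖ - 1)]
    refine h6.trans ?_
    gcongr
  have hP : 0 < (2 * π * (2 * s)) ^ (-(n : ℝ) / 2) := by positivity
  have e : (2 * π * s) ^ (-(n : ℝ) / 2) / (2 * π * (2 * s)) ^ (-(n : ℝ) / 2) * ((1 + 4 * s) * ‖v‖)
      * gaussKernel n (2 * s) w
      = gaussKernel n s w * (((1 + 4 * s) * Real.exp (‖w‖ ^ 2 / (4 * s))) * ‖v‖) := by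
    unfold gaussKernel
    have : Real.exp (-‖w‖ ^ 2 / (2 * (2 * s)))
        = Real.exp (-‖w‖ ^ 2 / (2 * s)) * Real.exp (‖w‖ ^ 2 / (4 * s)) := by
      rw [← Real.exp_add]; congr 1; field_simp; ring
    rw [this]
    field_simp
  rw [e]
  refine mul_le_mul_of_nonneg_left (h3.trans ?_) (gk_pos hs w).le
  gcongr

lemma gk_inner_integral (s : ℝ) (v : EuclideanSpace ℝ (Fin n)) :
    ∫ w, gaussKernel n s w * ⟪w, v⟫ = 0 := by
  have h := integral_neg_eq_self (fun w => gaussKernel n s w * ⟪w, v⟫)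
    (volume : Measure (EuclideanSpace ℝ (Fin n)))
  have e : ∀ w, gaussKernel n s (-w) * ⟪-w, v⟫ = -(gaussKernel n s w * ⟪w, v⟫) := by
    intro w; simp [gaussKernel, inner_neg_left]
  simp_rw [e] at h
  rw [integral_neg] at h
  linarith

lemma gk_log {s : ℝ} (hs : 0 < s) (z : EuclideanSpace ℝ (Fin n)) :
    Real.log (gaussKernel n s z)
      = -(n : ℝ) / 2 * (Real.log (2 * π) + Real.log s) - ‖z‖ ^ 2 / (2 * s) := by
  unfold gaussKernel
  rw [Real.log_mul (by positivity) (by positivity), Real.log_exp, Real.log_rpow (by positivity),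
    Real.log_mul (by positivity) (by positivity)]
  ring

lemma kl_pointwise {s : ℝ} (hs : 0 < s) (hs1 : s ≤ 1) (x v : EuclideanSpace ℝ (Fin n)) :
    klFun (gaussKernel n s (x - v) / gaussKernel n 1 x) * gaussKernel n 1 x
      ≤ gaussKernel n s (x - v) * (-(n : ℝ) / 2 * Real.log s + ‖v‖ ^ 2 / 2)
        + gaussKernel n s (x - v) * ⟪x - v, v⟫ + gaussKernel n 1 x - gaussKernel n s (x - v) := by
  have hk := gk_pos hs (x - v)
  have hg := gk_pos one_pos x
  rw [InformationTheory.klFun_apply, Real.log_div hk.ne' hg.ne', gk_log hs, gk_log one_pos]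
  have e : ‖x‖ ^ 2 = ‖x - v‖ ^ 2 + 2 * ⟪x - v, v⟫ + ‖v‖ ^ 2 := by
    rw [← norm_add_sq_real]; simp
  have h1 : ‖x - v‖ ^ 2 / 2 ≤ ‖x - v‖ ^ 2 / (2 * s) := by
    apply div_le_div_of_nonneg_left <;> first | positivity | linarith
  set k := gaussKernel n s (x - v)
  set g := gaussKernel n 1 x
  have h2 : (k / g * (-(n : ℝ) / 2 * (Real.log (2 * π) + Real.log s) - ‖x - v‖ ^ 2 / (2 * s)
      - (-(n : ℝ) / 2 * (Real.log (2 * π) + Real.log 1) - ‖x‖ ^ 2 / (2 * 1))) + 1 - k / g) * g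
      = k * (-(n : ℝ) / 2 * Real.log s - ‖x - v‖ ^ 2 / (2 * s) + ‖x‖ ^ 2 / 2) + g - k := by
    rw [Real.log_one]
    field_simp
    ring
  rw [h2, e]
  have := mul_le_mul_of_nonneg_left h1 hk.le
  nlinarith

lemma kl_inner {s : ℝ} (hs : 0 < s) (hs1 : s ≤ 1) (v : EuclideanSpace ℝ (Fin n)) :
    ∫⁻ x, ENNReal.ofReal
        (klFun (gaussKernel n s (x - v) / gaussKernel n 1 x) * gaussKernel n 1 x)
      ≤ ENNReal.ofReal (-(n : ℝ) / 2 * Real.log s + ‖v‖ ^ 2 / 2) := by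
  set C := -(n : ℝ) / 2 * Real.log s + ‖v‖ ^ 2 / 2
  refine (lintegral_mono fun x => ENNReal.ofReal_le_ofReal (kl_pointwise hs hs1 x v)).trans ?_
  have i1 : Integrable (fun x => gaussKernel n s (x - v)) := (gk_integrable hs).comp_sub_right v
  have i2 : Integrable (fun x => gaussKernel n s (x - v) * ⟪x - v, v⟫) :=
    (gk_inner_integrable hs v).comp_sub_right v
  have i3 := gk_integrable (n := n) one_pos
  have i4 := i1.mul_const C
  have i6 : Integrable (fun x => gaussKernel n s (x - v) * C
      + gaussKernel n s (x - v) * ⟪x - v, v⟫) := i4.add i2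
  have i7 : Integrable (fun x => gaussKernel n s (x - v) * C
      + gaussKernel n s (x - v) * ⟪x - v, v⟫ + gaussKernel n 1 x) := i6.add i3
  have i5 : Integrable (fun x => gaussKernel n s (x - v) * C + gaussKernel n s (x - v) * ⟪x - v, v⟫
      + gaussKernel n 1 x - gaussKernel n s (x - v)) := i7.sub i1
  rw [← ofReal_integral_eq_lintegral_ofReal i5]
  · apply le_of_eq
    congr 1
    have e1 := integral_sub_right_eq_self (fun x => gaussKernel n s x) (μ := volume) v
    have e2 := integral_sub_right_eq_self (fun x => gaussKernel n s x * ⟪x, v⟫) (μ := volume) v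
    rw [integral_sub i7 i1, integral_add i6 i3, integral_add i4 i2,
      integral_mul_const, e1, e2, gk_integral hs, gk_integral one_pos, gk_inner_integral]
    ring
  · refine ae_of_all _ fun x => le_trans ?_ (kl_pointwise hs hs1 x v)
    exact mul_nonneg (InformationTheory.klFun_nonneg
      (div_nonneg (gk_pos hs _).le (gk_pos one_pos _).le)) (gk_pos one_pos _).le

lemma gk_le {s : ℝ} (hs : 0 < s) (z : EuclideanSpace ℝ (Fin n)) :
    gaussKernel n s z ≤ (2 * π * s) ^ (-(n : ℝ) / 2) := by
  unfold gaussKernel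
  have : Real.exp (-‖z‖ ^ 2 / (2 * s)) ≤ 1 := by
    rw [Real.exp_le_one_iff]
    exact div_nonpos_of_nonpos_of_nonneg (by simp) (by positivity)
  exact mul_le_of_le_one_right (by positivity) this

lemma kl_main (μ : Measure (EuclideanSpace ℝ (Fin n))) [IsProbabilityMeasure μ]
    {s a : ℝ} (hs : 0 < s) (hs1 : s ≤ 1) :
    klDiv (densMeasure n fun x => ∫ y, gaussKernel n s (x - a • y) ∂μ) (stdGaussian n)
      ≤ ∫⁻ y, ENNReal.ofReal (-(n : ℝ) / 2 * Real.log s + ‖a • y‖ ^ 2 / 2) ∂μ := by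
  have hKc : Continuous (fun p : EuclideanSpace ℝ (Fin n) × EuclideanSpace ℝ (Fin n) =>
      gaussKernel n s (p.1 - a • p.2)) := (gk_cont s).comp (by fun_prop)
  have hKi : ∀ x, Integrable (fun y => gaussKernel n s (x - a • y)) μ := by
    intro x
    refine Integrable.of_bound ((gk_cont s).comp (by fun_prop)).aestronglyMeasurable
      ((2 * π * s) ^ (-(n : ℝ) / 2)) (ae_of_all _ fun y => ?_)
    rw [Real.norm_of_nonneg (gk_pos hs _).le]
    exact gk_le hs _
  set q : EuclideanSpace ℝ (Fin n) → ℝ := fun x => ∫ y, gaussKernel n s (x - a • y) ∂μ with hq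
  have hqm : Measurable q :=
    (hKc.stronglyMeasurable.integral_prod_right' (ν := μ)).measurable
  have hq0 : ∀ x, 0 ≤ q x := fun x => integral_nonneg fun y => (gk_pos hs _).le
  have hgm : Measurable (gaussKernel n 1) := (gk_cont 1).measurable
  have hν : IsProbabilityMeasure (stdGaussian n) := by
    refine ⟨?_⟩
    rw [stdGaussian, densMeasure, withDensity_apply _ MeasurableSet.univ, Measure.restrict_univ]
    exact gk_lintegral one_pos
  have hμ' : IsProbabilityMeasure (densMeasure n q) := by
    refine ⟨?_⟩
    rw [densMeasure, withDensity_apply _ MeasurableSet.univ, Measure.restrict_univ]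
    have e : ∀ x, ENNReal.ofReal (q x)
        = ∫⁻ y, ENNReal.ofReal (gaussKernel n s (x - a • y)) ∂μ := fun x =>
      ofReal_integral_eq_lintegral_ofReal (hKi x) (ae_of_all _ fun y => (gk_pos hs _).le)
    simp_rw [e]
    rw [lintegral_lintegral_swap (hKc.measurable.ennreal_ofReal).aemeasurable]
    have e3 : ∀ y, ∫⁻ x, ENNReal.ofReal (gaussKernel n s (x - a • y)) = 1 := fun y => by
      rw [lintegral_sub_right_eq_self (fun x => ENNReal.ofReal (gaussKernel n s x)) (a • y)]
      exact gk_lintegral hs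
    simp [e3]
  have hrm : Measurable fun x => ENNReal.ofReal (q x / gaussKernel n 1 x) :=
    (hqm.div hgm).ennreal_ofReal
  have hwd : densMeasure n q
      = (stdGaussian n).withDensity fun x => ENNReal.ofReal (q x / gaussKernel n 1 x) := by
    rw [stdGaussian, densMeasure, densMeasure, ← withDensity_mul _ hgm.ennreal_ofReal hrm]
    congr 1
    ext x
    have := gk_pos one_pos x
    rw [Pi.mul_apply, ← ENNReal.ofReal_mul this.le, mul_div_cancel₀ _ this.ne']
  have hac : densMeasure n q ≪ stdGaussian n := by
    rw [hwd]; exact withDensity_absolutelyContinuous _ _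
  have hkl : klDiv (densMeasure n q) (stdGaussian n)
      = InformationTheory.klDiv (densMeasure n q) (stdGaussian n) := by
    rw [InformationTheory.klDiv_def, klDiv]
    simp
  rw [hkl, InformationTheory.klDiv_eq_lintegral_klFun_of_ac hac]
  have hrn : (densMeasure n q).rnDeriv (stdGaussian n)
      =ᵐ[stdGaussian n] fun x => ENNReal.ofReal (q x / gaussKernel n 1 x) := by
    rw [hwd]; exact Measure.rnDeriv_withDensity _ hrm
  have hstep : ∫⁻ x, ENNReal.ofReal (klFun ((densMeasure n q).rnDeriv (stdGaussian n) x).toReal)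
        ∂(stdGaussian n)
      = ∫⁻ x, ENNReal.ofReal (klFun (q x / gaussKernel n 1 x) * gaussKernel n 1 x) := by
    have : ∫⁻ x, ENNReal.ofReal (klFun ((densMeasure n q).rnDeriv (stdGaussian n) x).toReal)
        ∂(stdGaussian n)
        = ∫⁻ x, ENNReal.ofReal (klFun (q x / gaussKernel n 1 x)) ∂(stdGaussian n) := by
      refine lintegral_congr_ae ?_
      filter_upwards [hrn] with x hx
      rw [hx, ENNReal.toReal_ofReal (div_nonneg (hq0 x) (gk_pos one_pos x).le)]
    rw [this]
    conv_lhs => rw [stdGaussian, densMeasure]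
    have hkm : Measurable fun x => ENNReal.ofReal (klFun (q x / gaussKernel n 1 x)) :=
      (InformationTheory.measurable_klFun.comp (hqm.div hgm)).ennreal_ofReal
    rw [lintegral_withDensity_eq_lintegral_mul _ hgm.ennreal_ofReal hkm]
    refine lintegral_congr fun x => ?_
    rw [Pi.mul_apply, ← ENNReal.ofReal_mul (gk_pos one_pos x).le, mul_comm]
  rw [hstep]
  have hJ : ∀ x, ENNReal.ofReal (klFun (q x / gaussKernel n 1 x) * gaussKernel n 1 x)
      ≤ ∫⁻ y, ENNReal.ofReal (klFun (gaussKernel n s (x - a • y) / gaussKernel n 1 x)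
        * gaussKernel n 1 x) ∂μ := by
    intro x
    have hg := gk_pos one_pos x
    have hui : Integrable (fun y => gaussKernel n s (x - a • y) / gaussKernel n 1 x) μ :=
      (hKi x).div_const _
    obtain ⟨B, hB⟩ := (isCompact_Icc (a := (0:ℝ))
      (b := (2 * π * s) ^ (-(n : ℝ) / 2) / gaussKernel n 1 x)).exists_bound_of_continuousOn
      InformationTheory.continuous_klFun.continuousOn
    have hci : Integrable
        (fun y => klFun (gaussKernel n s (x - a • y) / gaussKernel n 1 x)) μ := by
      refine Integrable.of_bound (C := B) ?_ (ae_of_all _ fun y => hB _ ⟨?_, ?_⟩)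
      · exact (InformationTheory.continuous_klFun.comp
          (((gk_cont s).comp (by fun_prop)).div_const _)).aestronglyMeasurable
      · exact div_nonneg (gk_pos hs _).le hg.le
      · exact div_le_div_of_nonneg_right (gk_le hs _) hg.le
    have hj := InformationTheory.convexOn_klFun.map_integral_le (μ := μ)
      InformationTheory.continuous_klFun.continuousOn isClosed_Ici
      (f := fun y => gaussKernel n s (x - a • y) / gaussKernel n 1 x)
      (ae_of_all _ fun y => div_nonneg (gk_pos hs _).le hg.le) hui hci
    rw [integral_div] at hj
    rw [← ofReal_integral_eq_lintegral_ofReal (hci.mul_const _), integral_mul_const]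
    · exact ENNReal.ofReal_le_ofReal (mul_le_mul_of_nonneg_right hj hg.le)
    · exact ae_of_all _ fun y => mul_nonneg (InformationTheory.klFun_nonneg
        (div_nonneg (gk_pos hs _).le hg.le)) hg.le
  refine (lintegral_mono hJ).trans ?_
  rw [lintegral_lintegral_swap]
  · exact lintegral_mono fun y => kl_inner hs hs1 (a • y)
  · have hg1 : Measurable fun p : EuclideanSpace ℝ (Fin n) × EuclideanSpace ℝ (Fin n) =>
      gaussKernel n 1 p.1 := hgm.comp measurable_fst
    exact (((InformationTheory.measurable_klFun.comp
      (hKc.measurable.div hg1)).mul hg1).ennreal_ofReal).aemeasurable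

end Helpers

/-- KL divergence of the VP marginals to the standard Gaussian tends to `0` as `t → ∞`,
for any probability density with finite second moment. -/
theorem stmt_1 (n : ℕ) (pH : EuclideanSpace ℝ (Fin n) → ℝ)
    (hnn : ∀ x, 0 ≤ pH x) (hint : Integrable pH) (hmass : ∫ x, pH x = 1)
    (hmom : Integrable fun x => ‖x‖ ^ 2 * pH x) :
    Tendsto (fun t => klDiv (densMeasure n (vpMarginal n pH t)) (stdGaussian n))
      atTop (𝓝 0) := by
  set μ := densMeasure n pH with hμ
  have hm : AEMeasurable (fun x => ENNReal.ofReal (pH x)) :=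
    hint.aestronglyMeasurable.aemeasurable.ennreal_ofReal
  have hlt : ∀ᵐ x : EuclideanSpace ℝ (Fin n), ENNReal.ofReal (pH x) < ∞ :=
    ae_of_all _ fun x => ENNReal.ofReal_lt_top
  have hprob : IsProbabilityMeasure μ := by
    refine ⟨?_⟩
    rw [hμ, densMeasure, withDensity_apply _ MeasurableSet.univ, Measure.restrict_univ,
      ← ofReal_integral_eq_lintegral_ofReal hint (ae_of_all _ hnn), hmass, ENNReal.ofReal_one]
  have hmi : Integrable (fun y => ‖y‖ ^ 2) μ := by
    rw [hμ, densMeasure, integrable_withDensity_iff_integrable_smul₀' hm hlt]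
    refine hmom.congr (ae_of_all _ fun x => ?_)
    simp only [smul_eq_mul]
    rw [ENNReal.toReal_ofReal (hnn x), mul_comm]
  set m := ∫ y, ‖y‖ ^ 2 ∂μ
  have hbound : ∀ᶠ t : ℝ in atTop,
      klDiv (densMeasure n (vpMarginal n pH t)) (stdGaussian n)
        ≤ ENNReal.ofReal (-(n : ℝ) / 2 * Real.log (1 - Real.exp (-t))
          + Real.exp (-t / 2) ^ 2 / 2 * m) := by
    filter_upwards [eventually_gt_atTop 0] with t ht
    have hs : 0 < 1 - Real.exp (-t) := by
      have : Real.exp (-t) < 1 := by rw [Real.exp_lt_one_iff]; linarith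
      linarith
    have hs1 : 1 - Real.exp (-t) ≤ 1 := by linarith [Real.exp_pos (-t)]
    have e : vpMarginal n pH t = fun x =>
        ∫ y, gaussKernel n (1 - Real.exp (-t)) (x - Real.exp (-t / 2) • y) ∂μ := by
      funext x
      rw [vpMarginal, if_neg ht.ne', hμ, densMeasure,
        integral_withDensity_eq_integral_toReal_smul₀ hm hlt]
      refine integral_congr_ae (ae_of_all _ fun y => ?_)
      simp only [smul_eq_mul]
      rw [ENNReal.toReal_ofReal (hnn y)]
    rw [e]
    refine (kl_main μ hs hs1).trans (le_of_eq ?_)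
    have e2 : ∀ y : EuclideanSpace ℝ (Fin n), ‖Real.exp (-t / 2) • y‖ ^ 2 / 2
        = Real.exp (-t / 2) ^ 2 / 2 * ‖y‖ ^ 2 := by
      intro y
      rw [norm_smul, Real.norm_of_nonneg (Real.exp_pos _).le]; ring
    simp_rw [e2]
    have i5 : Integrable (fun y => -(n : ℝ) / 2 * Real.log (1 - Real.exp (-t))
        + Real.exp (-t / 2) ^ 2 / 2 * ‖y‖ ^ 2) μ := (integrable_const _).add (hmi.const_mul _)
    rw [← ofReal_integral_eq_lintegral_ofReal i5, integral_add (integrable_const _)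
      (hmi.const_mul _)]
    · have e3 : ∫ y, Real.exp (-t / 2) ^ 2 / 2 * ‖y‖ ^ 2 ∂μ = Real.exp (-t / 2) ^ 2 / 2 * m :=
        integral_const_mul _ _
      rw [e3]
      simp
    · refine ae_of_all _ fun y => ?_
      have : Real.log (1 - Real.exp (-t)) ≤ 0 := Real.log_nonpos hs.le hs1
      have h1 : 0 ≤ -(n : ℝ) / 2 * Real.log (1 - Real.exp (-t)) :=
        mul_nonneg_of_nonpos_of_nonpos
          (div_nonpos_of_nonpos_of_nonneg (by simp) (by norm_num)) this
      simp only [Pi.zero_apply]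
      positivity
  have hlim : Tendsto (fun t : ℝ => ENNReal.ofReal (-(n : ℝ) / 2 * Real.log (1 - Real.exp (-t))
          + Real.exp (-t / 2) ^ 2 / 2 * m)) atTop (𝓝 0) := by
    have t1 : Tendsto (fun t : ℝ => Real.exp (-t)) atTop (𝓝 0) :=
      Real.tendsto_exp_neg_atTop_nhds_zero
    have t2 : Tendsto (fun t : ℝ => Real.log (1 - Real.exp (-t))) atTop (𝓝 0) := by
      have h := (tendsto_const_nhds (x := (1:ℝ))).sub t1
      have := h.log (by norm_num)
      simpa using this
    have t3 : Tendsto (fun t : ℝ => Real.exp (-t / 2) ^ 2) atTop (𝓝 0) := by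
      refine t1.congr fun t => ?_
      rw [← Real.exp_nat_mul]; congr 1; push_cast; ring
    have := ENNReal.tendsto_ofReal ((t2.const_mul (-(n : ℝ) / 2)).add ((t3.div_const 2).mul_const m))
    simpa using this
  exact tendsto_of_tendsto_of_tendsto_of_le_of_le' tendsto_const_nhds hlim
    (Eventually.of_forall fun _ => zero_le) hbound
end

section
/- Let p_H be a twice continuously differentiable, strictly positive probability density on ℝ^n with p_H, ∇p_H, ∇²p_H bounded and ∫‖x‖² p_H(x) dx < ∞. Suppose the VP marginals p_t are strictly positive and log p_t is twice differentiable for t ≥ 0, with sup_{x∈ℝ^n} ‖∇² log p_t(x)‖ ≤ L(t) < ∞ for every t ≥ 0 and ∫_0^T (1 + L(t)) dt < ∞ for all 0 < T < ∞. Assume for each T > 0 a bijection φ_{0→T} : ℝ^n → ℝ^n is given which is a flow map of v from time 0 to time T and transports p_H to p_T. Then KL(p_H·λ ‖ (φ_{0→T}^{-1})_# γ_n) → 0 and ‖p_H·λ − (φ_{0→T}^{-1})_# γ_n‖_TV → 0 as T → ∞. -/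
open MeasureTheory Real Filter Set
open scoped ENNReal Topology RealInnerProductSpace Classical

section helpers
variable {n : ℕ}

lemma gK_pos {s2 : ℝ} (h : 0 < s2) (z : EuclideanSpace ℝ (Fin n)) : 0 < gaussKernel n s2 z := by
  unfold gaussKernel; positivity

lemma gK_cont (s2 : ℝ) : Continuous (gaussKernel n s2) := by
  unfold gaussKernel; fun_prop

lemma exp_int {b : ℝ} (hb : 0 < b) :
    Integrable (fun z : EuclideanSpace ℝ (Fin n) => Real.exp (-b * ‖z‖ ^ 2)) := by
  have h := GaussianFourier.integral_rexp_neg_mul_sq_norm (V := EuclideanSpace ℝ (Fin n)) hb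
  by_contra hc
  rw [integral_undef hc] at h
  have : 0 < (π / b) ^ (Module.finrank ℝ (EuclideanSpace ℝ (Fin n)) / 2 : ℝ) := by positivity
  linarith

lemma gK_eq {s2 : ℝ} (h : 0 < s2) (z : EuclideanSpace ℝ (Fin n)) :
    gaussKernel n s2 z = (2 * π * s2) ^ (-(n : ℝ) / 2) * Real.exp (-(1 / (2 * s2)) * ‖z‖ ^ 2) := by
  unfold gaussKernel
  congr 2
  field_simp

lemma gK_int {s2 : ℝ} (h : 0 < s2) : Integrable (gaussKernel n s2) := by
  have := (exp_int (n := n) (b := 1 / (2 * s2)) (by positivity)).const_mul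
    ((2 * π * s2) ^ (-(n : ℝ) / 2))
  exact this.congr (Eventually.of_forall fun z => (gK_eq h z).symm)

lemma gK_integral {s2 : ℝ} (h : 0 < s2) : ∫ z, gaussKernel n s2 z = 1 := by
  simp_rw [gK_eq h]
  rw [integral_const_mul, GaussianFourier.integral_rexp_neg_mul_sq_norm (by positivity)]
  rw [finrank_euclideanSpace, Fintype.card_fin]
  have : π / (1 / (2 * s2)) = 2 * π * s2 := by field_simp
  rw [this, ← Real.rpow_add (by positivity)]
  have : -(n : ℝ) / 2 + n / 2 = 0 := by ring
  rw [this, Real.rpow_zero]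

lemma sq_exp_int : Integrable (fun z : EuclideanSpace ℝ (Fin n) =>
    π ^ (-(n : ℝ) / 2) * (‖z‖ ^ 2 * Real.exp (-‖z‖ ^ 2 / 2))) := by
  apply Integrable.const_mul
  refine ((exp_int (n := n) (b := 1 / 4) (by norm_num)).const_mul 4).mono'
    (by fun_prop) (Eventually.of_forall fun z => ?_)
  rw [Real.norm_of_nonneg (by positivity)]
  have h1 : Real.exp (-‖z‖ ^ 2 / 2) = Real.exp (-(1 / 4) * ‖z‖ ^ 2) * Real.exp (-(‖z‖ ^ 2 / 4)) := by
    rw [← Real.exp_add]; ring_nf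
  have h2 : ‖z‖ ^ 2 / 4 * Real.exp (-(‖z‖ ^ 2 / 4)) ≤ 1 := by
    rw [Real.exp_neg, ← div_eq_mul_inv, div_le_one (by positivity)]
    linarith [Real.add_one_le_exp (‖z‖ ^ 2 / 4)]
  rw [h1]
  have h3 := Real.exp_pos (-(1 / 4) * ‖z‖ ^ 2)
  nlinarith

lemma gK_le {s2 : ℝ} (h : 1 / 2 ≤ s2) (h1 : s2 ≤ 1) (z : EuclideanSpace ℝ (Fin n)) :
    gaussKernel n s2 z ≤ π ^ (-(n : ℝ) / 2) * Real.exp (-‖z‖ ^ 2 / 2) := by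
  unfold gaussKernel
  have hs : 0 < s2 := by linarith
  gcongr ?_ * Real.exp ?_
  · apply Real.rpow_le_rpow_of_nonpos (by positivity)
    · nlinarith [Real.pi_pos]
    · have : (0 : ℝ) ≤ n := by positivity
      linarith
  · rw [div_le_div_iff₀ (by positivity) (by norm_num)]
    nlinarith [sq_nonneg ‖z‖]

lemma gK_mom {s2 : ℝ} (h : 1 / 2 ≤ s2) (h1 : s2 ≤ 1) :
    Integrable (fun z : EuclideanSpace ℝ (Fin n) => ‖z‖ ^ 2 * gaussKernel n s2 z) ∧
    ∫ z : EuclideanSpace ℝ (Fin n), ‖z‖ ^ 2 * gaussKernel n s2 z ≤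
      ∫ z : EuclideanSpace ℝ (Fin n), π ^ (-(n : ℝ) / 2) * (‖z‖ ^ 2 * Real.exp (-‖z‖ ^ 2 / 2)) := by
  have hs : 0 < s2 := by linarith
  have hle : ∀ z : EuclideanSpace ℝ (Fin n), ‖z‖ ^ 2 * gaussKernel n s2 z ≤
      π ^ (-(n : ℝ) / 2) * (‖z‖ ^ 2 * Real.exp (-‖z‖ ^ 2 / 2)) := fun z => by
    have := mul_le_mul_of_nonneg_left (gK_le h h1 z) (sq_nonneg ‖z‖)
    linarith
  have hi : Integrable (fun z : EuclideanSpace ℝ (Fin n) => ‖z‖ ^ 2 * gaussKernel n s2 z) := by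
    refine sq_exp_int.mono' ?_ (Eventually.of_forall fun z => ?_)
    · have := gK_cont (n := n) s2
      exact Continuous.aestronglyMeasurable (by fun_prop)
    · rw [Real.norm_of_nonneg (mul_nonneg (sq_nonneg _) (gK_pos hs z).le)]
      exact hle z
  exact ⟨hi, integral_mono hi sq_exp_int hle⟩

lemma log_ratio_le {s2 a : ℝ} (h : 1 / 2 ≤ s2) (h1 : s2 ≤ 1) (ha : 0 ≤ a) (ha1 : a ≤ 1)
    (x y : EuclideanSpace ℝ (Fin n)) :
    Real.log (gaussKernel n s2 (x - a • y) / gaussKernel n 1 x) ≤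
      -(n / 2) * Real.log s2 + a / 2 * ‖x - a • y‖ ^ 2 + a * ‖y‖ ^ 2 := by
  have hs : 0 < s2 := by linarith
  rw [Real.log_div (gK_pos hs _).ne' (gK_pos one_pos _).ne']
  unfold gaussKernel
  rw [Real.log_mul (by positivity) (by positivity), Real.log_mul (by positivity) (by positivity),
    Real.log_exp, Real.log_exp, Real.log_rpow (by positivity), Real.log_rpow (by positivity),
    Real.log_mul (by positivity) hs.ne', mul_one]
  have e : ‖x‖ ^ 2 = ‖x - a • y‖ ^ 2 + 2 * (a * inner ℝ (x - a • y) y) + a ^ 2 * ‖y‖ ^ 2 := by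
    have : x = (x - a • y) + a • y := by simp
    conv_lhs => rw [this]
    rw [norm_add_sq_real, inner_smul_right, norm_smul, Real.norm_of_nonneg ha]
    ring
  have i : inner ℝ (x - a • y) y ≤ ‖x - a • y‖ * ‖y‖ := real_inner_le_norm _ _
  have j : 2 * inner ℝ (x - a • y) y ≤ ‖x - a • y‖ ^ 2 + ‖y‖ ^ 2 := by
    nlinarith [sq_nonneg (‖x - a • y‖ - ‖y‖)]
  have k : -‖x - a • y‖ ^ 2 / (2 * s2) ≤ -‖x - a • y‖ ^ 2 / 2 := by
    rw [div_le_div_iff₀ (by positivity) (by norm_num)]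
    nlinarith [sq_nonneg ‖x - a • y‖]
  have l : a ^ 2 * ‖y‖ ^ 2 ≤ a * ‖y‖ ^ 2 := by
    gcongr; nlinarith
  have m := mul_le_mul_of_nonneg_left j ha
  have q : -‖x‖ ^ 2 / (2 * 1) = -‖x‖^2/2 := by ring
  try rw [q]
  rw [e]
  nlinarith

lemma mul_log_ge {u v : ℝ} (hu : 0 < u) (hv : 0 < v) : u - v ≤ u * Real.log (u / v) := by
  have := Real.log_le_sub_one_of_pos (div_pos hv hu)
  have e : Real.log (u / v) = -Real.log (v / u) := by rw [← Real.log_inv, inv_div]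
  rw [e]
  have := mul_le_mul_of_nonneg_left this hu.le
  have : u * (v / u - 1) = v - u := by field_simp
  linarith

/-- Bound for KL. -/
noncomputable def klBound (n : ℕ) (M2 : ℝ) (T : ℝ) : ℝ :=
  -(n / 2) * Real.log (1 - Real.exp (-T)) + Real.exp (-T / 2) / 2 *
    (∫ z : EuclideanSpace ℝ (Fin n), π ^ (-(n : ℝ) / 2) * (‖z‖ ^ 2 * Real.exp (-‖z‖ ^ 2 / 2)))
    + Real.exp (-T / 2) * M2 + Real.exp (-T / 2)

lemma klBound_tendsto (M2 : ℝ) : Tendsto (klBound n M2) atTop (𝓝 0) := by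
  have h1 : Tendsto (fun T : ℝ => Real.exp (-T)) atTop (𝓝 0) := Real.tendsto_exp_neg_atTop_nhds_zero
  have h2 : Tendsto (fun T : ℝ => Real.exp (-T / 2)) atTop (𝓝 0) := by
    have := h1.comp (tendsto_id.atTop_div_const (show (0:ℝ) < 2 by norm_num))
    refine this.congr fun T => ?_
    simp [neg_div]
  have h3 : Tendsto (fun T : ℝ => Real.log (1 - Real.exp (-T))) atTop (𝓝 0) := by
    have : Tendsto (fun T : ℝ => 1 - Real.exp (-T)) atTop (𝓝 1) := by
      simpa using h1.const_sub 1
    have := this.log one_ne_zero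
    simpa using this
  unfold klBound
  have := (((h3.const_mul (-((n : ℝ) / 2))).add ((h2.div_const 2).mul_const
    (∫ z : EuclideanSpace ℝ (Fin n), π ^ (-(n : ℝ) / 2) * (‖z‖ ^ 2 * Real.exp (-‖z‖ ^ 2 / 2))))).add
    (h2.mul_const M2)).add h2
  simpa using this

lemma analytic (pH : EuclideanSpace ℝ (Fin n) → ℝ) (hc : Continuous pH) (hp : ∀ x, 0 < pH x)
    (hint : Integrable pH) (hmass : ∫ x, pH x = 1)
    (hmom : Integrable fun x => ‖x‖ ^ 2 * pH x) (T : ℝ) (hT : Real.exp (-T) ≤ 1 / 2) (hT0 : 0 < T)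
    (hpos : ∀ x, 0 < vpMarginal n pH T x) (hm : Measurable (vpMarginal n pH T)) :
    Integrable (vpMarginal n pH T) ∧ ∫ x, vpMarginal n pH T x = 1 ∧
    Integrable (fun x => vpMarginal n pH T x *
      Real.log (vpMarginal n pH T x / gaussKernel n 1 x)) ∧
    ∫ x, vpMarginal n pH T x * Real.log (vpMarginal n pH T x / gaussKernel n 1 x) ≤
      klBound n (∫ x, ‖x‖ ^ 2 * pH x) T ∧ 0 < klBound n (∫ x, ‖x‖ ^ 2 * pH x) T := by
  set s2 := 1 - Real.exp (-T) with hs2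
  set a := Real.exp (-T / 2) with ha
  have h : 1 / 2 ≤ s2 := by linarith
  have h1 : s2 ≤ 1 := by linarith [Real.exp_pos (-T)]
  have hs : 0 < s2 := by linarith
  have ha0 : 0 < a := Real.exp_pos _
  have ha1 : a ≤ 1 := Real.exp_le_one_iff.2 (by linarith)
  have hpe : ∀ x, vpMarginal n pH T x = ∫ y, pH y * gaussKernel n s2 (x - a • y) := fun x => by
    simp only [vpMarginal, hT0.ne', if_false, hs2, ha]
  set p := vpMarginal n pH T with hpdef
  set c : ℝ := -(n / 2) * Real.log s2 with hcdef
  have hc0 : 0 ≤ c := by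
    have := Real.log_nonpos hs.le h1
    have : (0 : ℝ) ≤ n := by positivity
    rw [hcdef]; nlinarith
  obtain ⟨hmi, hml⟩ := gK_mom (n := n) h h1
  have gc := gK_cont (n := n) s2
  -- product functions
  let V : EuclideanSpace ℝ (Fin n) × EuclideanSpace ℝ (Fin n) → ℝ := fun q =>
    pH q.2 * gaussKernel n s2 (q.1 - a • q.2)
  let U : EuclideanSpace ℝ (Fin n) × EuclideanSpace ℝ (Fin n) → ℝ := fun q =>
    pH q.2 * (gaussKernel n s2 (q.1 - a • q.2) *
      (c + a / 2 * ‖q.1 - a • q.2‖ ^ 2 + a * ‖q.2‖ ^ 2))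
  have hVc : Continuous V := by fun_prop
  have hUc : Continuous U := by fun_prop
  have hV0 : ∀ q, 0 ≤ V q := fun q => mul_nonneg (hp _).le (gK_pos hs _).le
  have hU0 : ∀ q, 0 ≤ U q := fun q =>
    mul_nonneg (hp _).le (mul_nonneg (gK_pos hs _).le (by positivity))
  have hVx : ∀ y, Integrable (fun x => V (x, y)) := fun y =>
    ((gK_int hs).comp_sub_right (a • y)).const_mul (pH y)
  have hWi : ∀ y : EuclideanSpace ℝ (Fin n), Integrable (fun w : EuclideanSpace ℝ (Fin n) =>
      (c + a * ‖y‖ ^ 2) * gaussKernel n s2 w + a / 2 * (‖w‖ ^ 2 * gaussKernel n s2 w)) := fun y =>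
    ((gK_int hs).const_mul _).add (hmi.const_mul _)
  have hUe : ∀ x y, U (x, y) = pH y * ((fun w : EuclideanSpace ℝ (Fin n) =>
      (c + a * ‖y‖ ^ 2) * gaussKernel n s2 w + a / 2 * (‖w‖ ^ 2 * gaussKernel n s2 w))
        (x - a • y)) := fun x y => by
    simp only [U]; ring
  have hUx : ∀ y, Integrable (fun x => U (x, y)) := fun y => by
    simp_rw [hUe]
    exact ((hWi y).comp_sub_right (a • y)).const_mul _
  have hVI : ∀ y, ∫ x, V (x, y) = pH y := fun y => by
    simp only [V]
    rw [integral_const_mul, integral_sub_right_eq_self (gaussKernel n s2), gK_integral hs, mul_one]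
  have hUI : ∀ y, ∫ x, U (x, y) = (c + a / 2 * ∫ w : EuclideanSpace ℝ (Fin n),
      ‖w‖ ^ 2 * gaussKernel n s2 w) * pH y + a * (‖y‖ ^ 2 * pH y) := fun y => by
    simp_rw [hUe]
    rw [integral_const_mul, integral_sub_right_eq_self (fun w : EuclideanSpace ℝ (Fin n) =>
      (c + a * ‖y‖ ^ 2) * gaussKernel n s2 w + a / 2 * (‖w‖ ^ 2 * gaussKernel n s2 w)),
      integral_add ((gK_int hs).const_mul _) (hmi.const_mul _), integral_const_mul,
      integral_const_mul, gK_integral hs]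
    ring
  have hVint : Integrable V (volume.prod volume) := by
    rw [integrable_prod_iff' hVc.aestronglyMeasurable]
    refine ⟨Eventually.of_forall hVx, ?_⟩
    simp_rw [Real.norm_of_nonneg (hV0 _), hVI]
    exact hint
  have hUint : Integrable U (volume.prod volume) := by
    rw [integrable_prod_iff' hUc.aestronglyMeasurable]
    refine ⟨Eventually.of_forall hUx, ?_⟩
    simp_rw [Real.norm_of_nonneg (hU0 _), hUI]
    exact (hint.const_mul _).add (hmom.const_mul _)
  have hpint : Integrable p := by
    refine hVint.integral_prod_left.congr (Eventually.of_forall fun x => ?_)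
    simp only [hpe, V]
  have hpmass : ∫ x, p x = 1 := by
    have : ∫ x, p x = ∫ x, ∫ y, V (x, y) := by
      congr 1; ext x; simp only [hpe, V]
    rw [this, integral_integral_swap (f := fun x y => V (x, y)) hVint]
    simp_rw [hVI]; exact hmass
  have hle : ∀ᵐ x, p x * Real.log (p x / gaussKernel n 1 x) ≤ ∫ y, U (x, y) := by
    filter_upwards [hUint.prod_right_ae, hVint.prod_right_ae] with x hxU hxV
    have e : p x * Real.log (p x / gaussKernel n 1 x) =
        ∫ y, (V (x, y) * (Real.log (p x / gaussKernel n 1 x) + 1) - pH y * p x) := by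
      rw [integral_sub (hxV.mul_const _) (hint.mul_const _), integral_mul_const,
        integral_mul_const, hmass]
      have : ∫ y, V (x, y) = p x := by simp only [hpe, V]
      rw [this]; ring
    rw [e]
    refine integral_mono ((hxV.mul_const _).sub (hint.mul_const _)) hxU fun y => ?_
    have k0 := gK_pos hs (x - a • y)
    have g0 := gK_pos (n := n) one_pos x
    have i1 := log_ratio_le h h1 ha0.le ha1 x y
    rw [← hcdef] at i1
    have i2 := mul_log_ge k0 (hpos x)
    have i3 : Real.log (gaussKernel n s2 (x - a • y) / p x) =
      Real.log (gaussKernel n s2 (x - a • y) / gaussKernel n 1 x) -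
        Real.log (p x / gaussKernel n 1 x) := by
      rw [Real.log_div k0.ne' (hpos x).ne', Real.log_div k0.ne' g0.ne',
        Real.log_div (hpos x).ne' g0.ne']; ring
    rw [i3] at i2
    have i4 := mul_le_mul_of_nonneg_left i1 k0.le
    have i5 : gaussKernel n s2 (x - a • y) * (Real.log (p x / gaussKernel n 1 x) + 1) - p x ≤
      gaussKernel n s2 (x - a • y) * (c + a / 2 * ‖x - a • y‖ ^ 2 + a * ‖y‖ ^ 2) := by
      linarith
    have i6 := mul_le_mul_of_nonneg_left i5 (hp y).le
    simp only [U, V]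
    linarith
  have hUi := hUint.integral_prod_left
  have hge : ∀ x, p x - gaussKernel n 1 x ≤ p x * Real.log (p x / gaussKernel n 1 x) := fun x =>
    mul_log_ge (hpos x) (gK_pos one_pos x)
  have hFm : Measurable fun x => p x * Real.log (p x / gaussKernel n 1 x) :=
    hm.mul (hm.div (gK_cont 1).measurable).log
  have hFi : Integrable (fun x => p x * Real.log (p x / gaussKernel n 1 x)) := by
    refine (hUi.add (hpint.add (gK_int one_pos))).mono' hFm.aestronglyMeasurable ?_
    filter_upwards [hle] with x hx
    have := hge x
    have hg := gK_pos (n := n) one_pos x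
    have hpx := hpos x
    have : 0 ≤ ∫ y, U (x, y) := integral_nonneg fun y => hU0 _
    simp only [Pi.add_apply]
    rw [Real.norm_eq_abs, abs_le]
    constructor <;> linarith
  have hN : 0 ≤ ∫ z : EuclideanSpace ℝ (Fin n), ‖z‖ ^ 2 * gaussKernel n s2 z :=
    integral_nonneg fun z => mul_nonneg (sq_nonneg _) (gK_pos hs z).le
  have hM2 : 0 ≤ ∫ z, ‖z‖ ^ 2 * pH z :=
    integral_nonneg fun z => mul_nonneg (sq_nonneg _) (hp z).le
  refine ⟨hpint, hpmass, hFi, ?_, ?_⟩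
  · calc _ ≤ ∫ x, ∫ y, U (x, y) := integral_mono_ae hFi hUi hle
      _ = ∫ y, ∫ x, U (x, y) := integral_integral_swap (f := fun x y => U (x, y)) hUint
      _ = c + a / 2 * (∫ w : EuclideanSpace ℝ (Fin n), ‖w‖ ^ 2 * gaussKernel n s2 w)
          + a * ∫ y, ‖y‖ ^ 2 * pH y := by
        simp_rw [hUI]
        rw [integral_add (hint.const_mul _) (hmom.const_mul _), integral_const_mul,
          integral_const_mul, hmass, mul_one]
      _ ≤ _ := by
        unfold klBound
        have := mul_le_mul_of_nonneg_left hml (show 0 ≤ a / 2 by positivity)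
        linarith
  · unfold klBound
    have : 0 ≤ a / 2 * (∫ z : EuclideanSpace ℝ (Fin n),
        π ^ (-(n : ℝ) / 2) * (‖z‖ ^ 2 * Real.exp (-‖z‖ ^ 2 / 2))) :=
      mul_nonneg (by positivity) (hN.trans hml)
    have : 0 ≤ a * ∫ z, ‖z‖ ^ 2 * pH z := mul_nonneg ha0.le hM2
    linarith

lemma abs_sub_le_kl {u v e : ℝ} (hu : 0 < u) (hv : 0 < v) (he : 0 < e) :
    |u - v| ≤ (1 + 1 / e) * (u * Real.log (u / v) - u + v) + e * v := by
  obtain ⟨s, hs, rfl⟩ : ∃ s, 0 < s ∧ u = s ^ 2 := ⟨√u, by positivity, (Real.sq_sqrt hu.le).symm⟩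
  obtain ⟨t, ht, rfl⟩ : ∃ s, 0 < s ∧ v = s ^ 2 := ⟨√v, by positivity, (Real.sq_sqrt hv.le).symm⟩
  have h1 := mul_log_ge hs ht
  have h2 : Real.log (s ^ 2 / t ^ 2) = 2 * Real.log (s / t) := by
    rw [← div_pow, Real.log_pow]; norm_num
  have h3 : (s - t) ^ 2 ≤ s ^ 2 * Real.log (s ^ 2 / t ^ 2) - s ^ 2 + t ^ 2 := by
    rw [h2]; nlinarith
  have h4 : |s ^ 2 - t ^ 2| ≤ (s - t) ^ 2 + 2 * |s - t| * t := by
    have : s ^ 2 - t ^ 2 = (s - t) ^ 2 + 2 * (s - t) * t := by ring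
    rw [this]
    refine (abs_add_le _ _).trans ?_
    rw [abs_mul, abs_mul, abs_of_pos ht, abs_of_nonneg (sq_nonneg _)]; norm_num
  have h5 : 2 * |s - t| * t ≤ 1 / e * (s - t) ^ 2 + e * t ^ 2 := by
    rw [← sq_abs (s - t)]
    have : 1 / e * |s - t| ^ 2 + e * t ^ 2 - 2 * |s - t| * t = 1 / e * (|s - t| - e * t) ^ 2 := by
      field_simp; ring
    have : 0 ≤ 1 / e * (|s - t| - e * t) ^ 2 := by positivity
    linarith
  have h6 : (1 + 1 / e) * (s - t) ^ 2 ≤ (1 + 1 / e) *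
      (s ^ 2 * Real.log (s ^ 2 / t ^ 2) - s ^ 2 + t ^ 2) :=
    mul_le_mul_of_nonneg_left h3 (by positivity)
  nlinarith

lemma transport {E : Type*} [MeasurableSpace E] [StandardBorelSpace E] [Nonempty E]
    (μ ν γ : Measure E) (hν : ν ≠ 0) (hγ : γ ≪ ν) (φ : E → E) (hb : Function.Bijective φ)
    (hmap : Measure.map φ μ = ν) :
    ∃ g h : E → E, Measurable g ∧ Measurable h ∧
      Measure.map (Function.invFun φ) γ = Measure.map h γ ∧ Measure.map h ν = μ ∧
      Measure.map g μ = ν ∧ ∀ᵐ y ∂γ, g (h y) = y := by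
  have hae : AEMeasurable φ μ := by
    by_contra hc
    rw [Measure.map_of_not_aemeasurable hc] at hmap
    exact hν hmap.symm
  obtain ⟨g, hg, hfg⟩ := hae
  obtain ⟨N, hN, hNm, hN0⟩ := exists_measurable_superset_of_null (ae_iff.1 hfg)
  set A := Nᶜ with hA
  have hAm : MeasurableSet A := hNm.compl
  have hAe : ∀ x ∈ A, φ x = g x := fun x hx => by
    by_contra hc; exact hx (hN hc)
  have hinj : Set.InjOn g A := fun x hx y hy hxy => by
    apply hb.1; rw [hAe x hx, hAe y hy, hxy]
  have hmapg : Measure.map g μ = ν := by rw [← hmap]; exact Measure.map_congr hfg.symm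
  set B := g '' A with hB
  have hBm : MeasurableSet B := hAm.image_of_measurable_injOn hg hinj
  have hBν : ν Bᶜ = 0 := by
    rw [← hmapg, Measure.map_apply hg hBm.compl]
    refine measure_mono_null (fun x hx => ?_) hN0
    by_contra hc
    exact hx ⟨x, hc, rfl⟩
  have hψ : ∀ x ∈ A, Function.invFun φ (g x) = x := fun x hx => by
    rw [← hAe x hx]; exact Function.leftInverse_invFun hb.1 x
  let z : E := Classical.arbitrary E
  let h : E → E := fun y => if y ∈ B then Function.invFun φ y else z
  have hhA : ∀ x ∈ A, h (g x) = x := fun x hx => by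
    have : g x ∈ B := ⟨x, hx, rfl⟩
    simp only [h, this, if_true, hψ x hx]
  have hhm : Measurable h := by
    intro s hs
    have : h ⁻¹' s = g '' (A ∩ s) ∪ (Bᶜ ∩ {_y | z ∈ s}) := by
      ext y
      by_cases hy : y ∈ B
      · obtain ⟨x, hx, rfl⟩ := hy
        simp only [mem_preimage, hhA x hx, mem_union, mem_inter_iff, mem_compl_iff]
        constructor
        · intro h; exact Or.inl ⟨x, ⟨hx, h⟩, rfl⟩
        · rintro (⟨x', ⟨h1, h2⟩, h3⟩ | h)
          · rwa [← hinj h1 hx h3]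
          · exact absurd ⟨x, hx, rfl⟩ h.1
      · have h1 : y ∉ g '' (A ∩ s) := fun ⟨x, hx, e⟩ => hy ⟨x, hx.1, e⟩
        simp [h, hy, h1]
    rw [this]
    exact ((hAm.inter hs).image_of_measurable_injOn hg (hinj.mono inter_subset_left)).union
      (hBm.compl.inter (MeasurableSet.const _))
  have hBae : ∀ᵐ y ∂γ, y ∈ B := hγ.ae_le (ae_iff.2 hBν)
  refine ⟨g, h, hg, hhm, Measure.map_congr ?_, ?_, hmapg, ?_⟩
  · filter_upwards [hBae] with y hy
    simp only [h, hy, if_true]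
  · rw [← hmapg, Measure.map_map hhm hg]
    have : h ∘ g =ᵐ[μ] id := by
      have : ∀ᵐ x ∂μ, x ∈ A := ae_iff.2 (by simpa [hA] using hN0)
      filter_upwards [this] with x hx using hhA x hx
    rw [Measure.map_congr this, Measure.map_id]
  · filter_upwards [hBae] with y hy
    obtain ⟨x, hx, rfl⟩ := hy
    rw [hhA x hx]

lemma dens_le (p q : EuclideanSpace ℝ (Fin n) → ℝ) (hi : Integrable p) (hj : Integrable q)
    (hqm : Measurable q)
    (s : Set (EuclideanSpace ℝ (Fin n))) (hs : MeasurableSet s) :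
    densMeasure n p s - densMeasure n q s ≤ ENNReal.ofReal (∫ x, |p x - q x|) := by
  unfold densMeasure
  have hab : Integrable (fun x => |p x - q x|) := (hi.sub hj).abs
  rw [tsub_le_iff_left, withDensity_apply _ hs, withDensity_apply _ hs,
    ofReal_integral_eq_lintegral_ofReal hab (Eventually.of_forall fun x => abs_nonneg _)]
  calc _ ≤ ∫⁻ x in s, (ENNReal.ofReal (q x) + ENNReal.ofReal |p x - q x|) := by
        refine lintegral_mono fun x => ?_
        refine le_trans (ENNReal.ofReal_le_ofReal ?_) ENNReal.ofReal_add_le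
        linarith [le_abs_self (p x - q x)]
    _ = (∫⁻ x in s, ENNReal.ofReal (q x)) + ∫⁻ x in s, ENNReal.ofReal |p x - q x| :=
        lintegral_add_left hqm.ennreal_ofReal _
    _ ≤ _ := by gcongr; exact Measure.restrict_le_self

/-- Final per-time estimate. -/
lemma final_est (μ : Measure (EuclideanSpace ℝ (Fin n))) (p : EuclideanSpace ℝ (Fin n) → ℝ)
    (hm : Measurable p) (hpos : ∀ x, 0 < p x) (hi : Integrable p) (h1 : ∫ x, p x = 1)
    (hF : Integrable (fun x => p x * Real.log (p x / gaussKernel n 1 x))) (K : ℝ) (hK : 0 < K)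
    (hFK : ∫ x, p x * Real.log (p x / gaussKernel n 1 x) ≤ K)
    (φ : EuclideanSpace ℝ (Fin n) → EuclideanSpace ℝ (Fin n)) (hb : Function.Bijective φ)
    (hmap : Measure.map φ μ = densMeasure n p) :
    klDiv μ (Measure.map (Function.invFun φ) (stdGaussian n)) ≤ ENNReal.ofReal K ∧
    tvDist μ (Measure.map (Function.invFun φ) (stdGaussian n)) ≤
      ENNReal.ofReal (K + 2 * √K) + ENNReal.ofReal (K + 2 * √K) := by
  set G := gaussKernel n 1 with hG
  have hGpos : ∀ x, 0 < G x := gK_pos one_pos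
  have hGm : Measurable G := (gK_cont 1).measurable
  have hGi : Integrable G := gK_int one_pos
  have hG1 : ∫ x, G x = 1 := gK_integral one_pos
  set γ := stdGaussian n with hγ
  have hγd : γ = volume.withDensity (fun x => ENNReal.ofReal (G x)) := rfl
  set ν := densMeasure n p with hν
  have hνd : ν = volume.withDensity (fun x => ENNReal.ofReal (p x)) := rfl
  have prob : ∀ q : EuclideanSpace ℝ (Fin n) → ℝ, (∀ x, 0 < q x) → Integrable q → ∫ x, q x = 1 →
      IsProbabilityMeasure (densMeasure n q) := fun q h0 h1 h2 => ⟨by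
    unfold densMeasure
    rw [withDensity_apply _ MeasurableSet.univ, Measure.restrict_univ,
      ← ofReal_integral_eq_lintegral_ofReal h1 (Eventually.of_forall fun x => (h0 x).le), h2,
      ENNReal.ofReal_one]⟩
  have : IsProbabilityMeasure ν := prob p hpos hi h1
  have : IsProbabilityMeasure γ := prob G hGpos hGi hG1
  let f : EuclideanSpace ℝ (Fin n) → ℝ≥0∞ := fun x => ENNReal.ofReal (p x / G x)
  have hfm : Measurable f := (hm.div hGm).ennreal_ofReal
  have hνγ : ν = γ.withDensity f := by
    rw [hγd, hνd, ← withDensity_mul _ hGm.ennreal_ofReal hfm]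
    congr 1; ext x
    simp only [f, Pi.mul_apply]
    rw [← ENNReal.ofReal_mul (hGpos x).le, mul_div_cancel₀ _ (hGpos x).ne']
  have hγν : γ ≪ ν := by
    have h1 : γ ≪ volume := withDensity_absolutelyContinuous _ _
    refine h1.trans (withDensity_absolutelyContinuous' hm.ennreal_ofReal.aemeasurable ?_)
    exact Eventually.of_forall fun x => by simpa using hpos x
  obtain ⟨g, h, hg, hh, e1, e2, e3, e4⟩ := transport μ ν γ (IsProbabilityMeasure.ne_zero ν) hγν
    φ hb hmap
  rw [e1]
  set ρ := Measure.map h γ with hρ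
  have : IsProbabilityMeasure ρ := Measure.isProbabilityMeasure_map hh.aemeasurable
  have hfg : Measurable (f ∘ g) := hfm.comp hg
  have hμρ : μ = ρ.withDensity (f ∘ g) := by
    rw [← e2]
    ext s hs
    rw [Measure.map_apply hh hs, hνγ, withDensity_apply _ (hh hs), withDensity_apply _ hs, hρ,
      setLIntegral_map hs hfg hh]
    refine lintegral_congr_ae (ae_restrict_of_ae ?_)
    filter_upwards [e4] with y hy
    simp only [Function.comp, hy]
  have hac : μ ≪ ρ := by rw [hμρ]; exact withDensity_absolutelyContinuous _ _
  have hllr : llr μ ρ =ᵐ[μ] fun x => Real.log (p (g x) / G (g x)) := by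
    have : μ.rnDeriv ρ =ᵐ[ρ] f ∘ g := by
      rw [hμρ]; exact Measure.rnDeriv_withDensity ρ hfg
    filter_upwards [hac.ae_le this] with x hx
    simp only [llr, hx, f, Function.comp]
    rw [ENNReal.toReal_ofReal (div_pos (hpos _) (hGpos _)).le]
  have hlm : Measurable fun x => Real.log (p x / G x) := (hm.div hGm).log
  have hνint : Integrable (fun x => Real.log (p x / G x)) ν := by
    rw [hνd, integrable_withDensity_iff hm.ennreal_ofReal (Eventually.of_forall fun x => by simp)]
    refine hF.congr (Eventually.of_forall fun x => ?_)
    simp only [ENNReal.toReal_ofReal (hpos x).le]; ring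
  have hνI : ∫ x, Real.log (p x / G x) ∂ν = ∫ x, p x * Real.log (p x / G x) := by
    rw [hνd, integral_withDensity_eq_integral_toReal_smul hm.ennreal_ofReal
      (Eventually.of_forall fun x => by simp)]
    congr 1; ext x
    simp only [ENNReal.toReal_ofReal (hpos x).le, smul_eq_mul]
  constructor
  · have hI : Integrable (llr μ ρ) μ := by
      refine Integrable.congr ?_ hllr.symm
      rw [← e3] at hνint
      exact (integrable_map_measure hlm.aestronglyMeasurable hg.aemeasurable).1 hνint
    unfold klDiv
    rw [if_pos ⟨hac, hI⟩]
    apply ENNReal.ofReal_le_ofReal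
    rw [integral_congr_ae hllr]
    rw [← e3, integral_map hg.aemeasurable hlm.aestronglyMeasurable] at hνI
    rw [hνI]; exact hFK
  · have hL1 : ∫ x, |p x - G x| ≤ K + 2 * √K := by
      have hsK : 0 < √K := Real.sqrt_pos.2 hK
      calc ∫ x, |p x - G x| ≤ ∫ x, ((1 + 1 / √K) * (p x * Real.log (p x / G x) - p x + G x)
            + √K * G x) := by
            refine integral_mono (hi.sub hGi).abs
              ((((hF.sub hi).add hGi).const_mul _).add (hGi.const_mul _)) fun x => ?_
            exact abs_sub_le_kl (hpos x) (hGpos x) hsK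
        _ = (1 + 1 / √K) * (∫ x, p x * Real.log (p x / G x)) + √K := by
            have j1 : Integrable (fun x => p x * Real.log (p x / G x) - p x) := hF.sub hi
            have j2 : Integrable (fun x => p x * Real.log (p x / G x) - p x + G x) := j1.add hGi
            rw [integral_add (j2.const_mul _) (hGi.const_mul _),
              integral_const_mul, integral_const_mul, integral_add j1 hGi,
              integral_sub hF hi, h1, hG1]
            ring
        _ ≤ (1 + 1 / √K) * K + √K := by gcongr
        _ = K + 2 * √K := by
            have : 1 / √K * K = √K := by
              rw [one_div, inv_mul_eq_div, Real.div_sqrt]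
            linarith
    unfold tvDist
    gcongr
    · refine iSup₂_le fun s hs => ?_
      rw [← e2, hρ, Measure.map_apply hh hs, Measure.map_apply hh hs]
      exact (dens_le p G hi hGi hGm _ (hh hs)).trans (ENNReal.ofReal_le_ofReal hL1)
    · refine iSup₂_le fun s hs => ?_
      rw [← e2, hρ, Measure.map_apply hh hs, Measure.map_apply hh hs]
      refine (dens_le G p hGi hi hm _ (hh hs)).trans (ENNReal.ofReal_le_ofReal ?_)
      simp_rw [abs_sub_comm (G _) (p _)]
      exact hL1

end helpers

/-- Corollary 1: for a bounded, strictly positive `C²` density with finite second moment and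
score regularity up to `t = 0`, the Gaussian pullbacks of the VP flow from time `0` converge
to `p_H` in KL divergence and in total variation as `T → ∞`. -/
theorem stmt_3 (n : ℕ) (pH : EuclideanSpace ℝ (Fin n) → ℝ)
    (hC2 : ContDiff ℝ 2 pH) (hpospH : ∀ x, 0 < pH x)
    (hbdd : ∃ C : ℝ, ∀ x, |pH x| ≤ C ∧ ‖fderiv ℝ pH x‖ ≤ C ∧
      ‖fderiv ℝ (fderiv ℝ pH) x‖ ≤ C)
    (hint : Integrable pH) (hmass : ∫ x, pH x = 1)
    (hmom : Integrable fun x => ‖x‖ ^ 2 * pH x)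
    (hpos : ∀ t ≥ (0 : ℝ), ∀ x, 0 < vpMarginal n pH t x)
    (L : ℝ → ℝ)
    (hreg : ∀ t ≥ (0 : ℝ),
      TwiceDiff (fun x => Real.log (vpMarginal n pH t x)) ∧
      ∀ x, ‖hessian (fun z => Real.log (vpMarginal n pH t z)) x‖ ≤ L t)
    (hLint : ∀ T > (0 : ℝ), IntegrableOn (fun t => 1 + L t) (Set.Icc 0 T))
    (φ : ℝ → EuclideanSpace ℝ (Fin n) → EuclideanSpace ℝ (Fin n))
    (hφ : ∀ T > (0 : ℝ),
      Function.Bijective (φ T) ∧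
      IsFlowMap n (vField n pH) 0 T (φ T) ∧
      Measure.map (φ T) (densMeasure n pH) = densMeasure n (vpMarginal n pH T)) :
    Tendsto (fun T => klDiv (densMeasure n pH)
        (Measure.map (Function.invFun (φ T)) (stdGaussian n))) atTop (𝓝 0) ∧
    Tendsto (fun T => tvDist (densMeasure n pH)
        (Measure.map (Function.invFun (φ T)) (stdGaussian n))) atTop (𝓝 0) := by
  have hM2 := klBound_tendsto (n := n) (∫ x, ‖x‖ ^ 2 * pH x)
  have key : ∀ᶠ T in atTop,
      klDiv (densMeasure n pH) (Measure.map (Function.invFun (φ T)) (stdGaussian n)) ≤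
        ENNReal.ofReal (klBound n (∫ x, ‖x‖ ^ 2 * pH x) T) ∧
      tvDist (densMeasure n pH) (Measure.map (Function.invFun (φ T)) (stdGaussian n)) ≤
        ENNReal.ofReal (klBound n (∫ x, ‖x‖ ^ 2 * pH x) T +
            2 * √(klBound n (∫ x, ‖x‖ ^ 2 * pH x) T)) +
          ENNReal.ofReal (klBound n (∫ x, ‖x‖ ^ 2 * pH x) T +
            2 * √(klBound n (∫ x, ‖x‖ ^ 2 * pH x) T)) := by
    have hexp : ∀ᶠ T : ℝ in atTop, Real.exp (-T) < 1 / 2 :=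
      Real.tendsto_exp_neg_atTop_nhds_zero.eventually_lt_const (by norm_num)
    filter_upwards [hexp, eventually_gt_atTop 0] with T hT hT0
    have hm : Measurable (vpMarginal n pH T) := by
      have h1 := ((hreg T hT0.le).1.1.continuous.measurable).exp
      have h2 : (fun x => Real.exp (Real.log (vpMarginal n pH T x))) = vpMarginal n pH T := by
        ext x; exact Real.exp_log (hpos T hT0.le x)
      rwa [h2] at h1
    obtain ⟨a1, a2, a3, a4, a5⟩ := analytic pH hC2.continuous hpospH hint hmass hmom T hT.le hT0
      (hpos T hT0.le) hm
    exact final_est _ _ hm (hpos T hT0.le) a1 a2 a3 _ a5 a4 (φ T) (hφ T hT0).1 (hφ T hT0).2.2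
  have t1 := ENNReal.tendsto_ofReal hM2
  have t2 := ENNReal.tendsto_ofReal (hM2.add (hM2.sqrt.const_mul 2))
  have t3 := t2.add t2
  simp only [Real.sqrt_zero, mul_zero, add_zero, ENNReal.ofReal_zero] at t1 t3
  exact ⟨tendsto_of_tendsto_of_tendsto_of_le_of_le' tendsto_const_nhds t1
      (Eventually.of_forall fun _ => zero_le) (key.mono fun _ h => h.1),
    tendsto_of_tendsto_of_tendsto_of_le_of_le' tendsto_const_nhds t3
      (Eventually.of_forall fun _ => zero_le) (key.mono fun _ h => h.2)⟩
end

section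
/- Let p_H be a probability density on ℝ^n whose support is contained in the closed ball of radius R centered at the origin. Then for every t > 0 the VP marginal p_t is strictly positive, log p_t is twice differentiable, and for all x ∈ ℝ^n the operator norm of the Hessian satisfies ‖∇² log p_t(x)‖ ≤ 1 + (e^{-t}/(1 − e^{-t})²)·R² + e^{-t}/(1 − e^{-t}). -/
open MeasureTheory Real Filter Set
open scoped ENNReal Topology RealInnerProductSpace Classical

section aux

variable {n : ℕ} {G : Type*} [NormedAddCommGroup G] [NormedSpace ℝ G]

theorem aux_int (b R : ℝ) (F : EuclideanSpace ℝ (Fin n) → G) (hF : Integrable F)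
    (hs : Function.support F ⊆ Metric.closedBall 0 R) (x : EuclideanSpace ℝ (Fin n)) :
    Integrable (fun y => Real.exp (b * inner ℝ x y) • F y) := by
  refine Integrable.mono' (g := fun y => Real.exp (|b| * (‖x‖ * R)) * ‖F y‖)
    (hF.norm.const_mul _) ?_ ?_
  · have : Continuous (fun y : EuclideanSpace ℝ (Fin n) => Real.exp (b * inner ℝ x y)) := by
      fun_prop
    exact this.aestronglyMeasurable.smul hF.1
  · refine Eventually.of_forall fun y => ?_
    by_cases hy : F y = 0
    · simp [hy]
    have hyR : ‖y‖ ≤ R := by simpa using hs hy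
    rw [norm_smul, Real.norm_eq_abs, Real.abs_exp]
    refine mul_le_mul_of_nonneg_right (Real.exp_le_exp.2 ?_) (norm_nonneg _)
    calc b * inner ℝ x y ≤ |b * inner ℝ x y| := le_abs_self _
      _ = |b| * |inner ℝ x y| := abs_mul _ _
      _ ≤ |b| * (‖x‖ * ‖y‖) := by gcongr; exact abs_real_inner_le_norm x y
      _ ≤ _ := by gcongr

noncomputable def auxD (b : ℝ) (F : EuclideanSpace ℝ (Fin n) → G) (y : EuclideanSpace ℝ (Fin n)) :
    EuclideanSpace ℝ (Fin n) →L[ℝ] G :=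
  (b • innerSL ℝ y).smulRight (F y)

theorem auxD_norm (b : ℝ) (F : EuclideanSpace ℝ (Fin n) → G) (y : EuclideanSpace ℝ (Fin n)) :
    ‖auxD b F y‖ = |b| * ‖y‖ * ‖F y‖ := by
  simp [auxD, ContinuousLinearMap.norm_smulRight_apply, norm_smul]

theorem auxD_supp (b R : ℝ) (F : EuclideanSpace ℝ (Fin n) → G)
    (hs : Function.support F ⊆ Metric.closedBall 0 R) :
    Function.support (auxD b F) ⊆ Metric.closedBall 0 R := by
  intro y hy
  apply hs
  intro h
  apply hy
  simp [auxD, h]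

theorem auxD_int (b R : ℝ) (F : EuclideanSpace ℝ (Fin n) → G) (hF : Integrable F)
    (hs : Function.support F ⊆ Metric.closedBall 0 R) : Integrable (auxD b F) := by
  refine Integrable.mono' (g := fun y => |b| * R * ‖F y‖) (hF.norm.const_mul _) ?_ ?_
  · have h1 : Continuous (fun y : EuclideanSpace ℝ (Fin n) => b • innerSL ℝ y) := by fun_prop
    exact (ContinuousLinearMap.smulRightL ℝ (EuclideanSpace ℝ (Fin n)) G).aestronglyMeasurable_comp₂
      h1.aestronglyMeasurable hF.1
  · refine Eventually.of_forall fun y => ?_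
    rw [auxD_norm]
    by_cases hy : F y = 0
    · simp [hy]
    have hyR : ‖y‖ ≤ R := by simpa using hs hy
    gcongr

theorem aux_deriv (b R : ℝ) (F : EuclideanSpace ℝ (Fin n) → G) (hF : Integrable F)
    (hs : Function.support F ⊆ Metric.closedBall 0 R) (x : EuclideanSpace ℝ (Fin n)) :
    HasFDerivAt (fun x => ∫ y, Real.exp (b * inner ℝ x y) • F y)
      (∫ y, Real.exp (b * inner ℝ x y) • auxD b F y) x := by
  have hD := auxD_int b R F hF hs
  have hDs := auxD_supp b R F hs
  refine hasFDerivAt_integral_of_dominated_of_fderiv_le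
    (F := fun x y => Real.exp (b * inner ℝ x y) • F y)
    (F' := fun x y => Real.exp (b * inner ℝ x y) • auxD b F y)
    (bound := fun y => Real.exp (|b| * ((‖x‖ + 1) * R)) * ‖auxD b F y‖)
    (Metric.ball_mem_nhds x one_pos)
    (Eventually.of_forall fun z => (aux_int b R F hF hs z).1) (aux_int b R F hF hs x)
    (aux_int b R _ hD hDs x).1 ?_ (hD.norm.const_mul _) ?_
  · refine Eventually.of_forall fun y z hz => ?_
    by_cases hy : auxD b F y = 0
    · simp [hy]
    have hyR : ‖y‖ ≤ R := by simpa using hDs hy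
    have hzn : ‖z‖ ≤ ‖x‖ + 1 := by
      have h1 : ‖z - x‖ < 1 := by simpa [dist_eq_norm] using hz
      have := norm_le_norm_add_norm_sub' z x
      linarith
    rw [norm_smul, Real.norm_eq_abs, Real.abs_exp]
    refine mul_le_mul_of_nonneg_right (Real.exp_le_exp.2 ?_) (norm_nonneg _)
    calc b * inner ℝ z y ≤ |b * inner ℝ z y| := le_abs_self _
      _ = |b| * |inner ℝ z y| := abs_mul _ _
      _ ≤ |b| * (‖z‖ * ‖y‖) := by gcongr; exact abs_real_inner_le_norm z y
      _ ≤ _ := by gcongr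
  · refine Eventually.of_forall fun y z _ => ?_
    have h0 : HasFDerivAt (fun z : EuclideanSpace ℝ (Fin n) => b * inner ℝ z y)
        (b • innerSL ℝ y) z := by
      have h := ((innerSL ℝ y).hasFDerivAt (x := z)).const_mul b
      refine h.congr_of_eventuallyEq (Eventually.of_forall fun w => ?_)
      simp [real_inner_comm]
    have h1 := h0.exp.smul_const (F y)
    convert h1 using 1
    ext v
    simp [auxD, smul_smul, mul_assoc]

theorem aux_bilin {E : Type*} [NormedAddCommGroup E] [InnerProductSpace ℝ E]
    (B : E →L[ℝ] E →L[ℝ] ℝ) (K : ℝ) (hK : 0 ≤ K) (hsym : ∀ u v, B u v = B v u)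
    (h0 : ∀ u, 0 ≤ B u u) (h1 : ∀ u, B u u ≤ K * ‖u‖ ^ 2) : ‖B‖ ≤ K := by
  have key : ∀ u v, ‖u‖ = 1 → ‖v‖ = 1 → B u v ≤ K := by
    intro u v hu hv
    have e1 := h0 (u - v)
    have e2 := h1 (u + v)
    have e3 : ‖u + v‖ ≤ 2 := by
      have := norm_add_le u v
      linarith
    have e4 : ‖u + v‖ ^ 2 ≤ 4 := by nlinarith [norm_nonneg (u + v)]
    have e5 := hsym u v
    simp only [map_add, map_sub, add_apply, sub_apply] at e1 e2
    have e6 := mul_le_mul_of_nonneg_left e4 hK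
    linarith
  refine ContinuousLinearMap.opNorm_le_of_unit_norm hK fun u hu => ?_
  refine ContinuousLinearMap.opNorm_le_of_unit_norm hK fun v hv => ?_
  rw [Real.norm_eq_abs, abs_le]
  constructor
  · have := key (-u) v (by simpa using hu) hv
    simp at this
    linarith
  · exact key u v hu hv

theorem aux_main (b R : ℝ) (q : EuclideanSpace ℝ (Fin n) → ℝ) (hq0 : ∀ y, 0 ≤ q y)
    (hq : Integrable q)
    (hs : Function.support q ⊆ Metric.closedBall 0 R)
    (Z : EuclideanSpace ℝ (Fin n) → ℝ)
    (hZ : Z = fun x => ∫ y, Real.exp (b * inner ℝ x y) • q y)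
    (hpos : ∀ x, 0 < Z x) :
    ∃ (Z1 : EuclideanSpace ℝ (Fin n) → EuclideanSpace ℝ (Fin n) →L[ℝ] ℝ)
      (Z2 : EuclideanSpace ℝ (Fin n) → EuclideanSpace ℝ (Fin n) →L[ℝ]
        EuclideanSpace ℝ (Fin n) →L[ℝ] ℝ),
      (∀ x, HasFDerivAt (fun x => Real.log (Z x)) (Z1 x) x) ∧
      (∀ x, HasFDerivAt Z1 (Z2 x) x) ∧ ∀ x, ‖Z2 x‖ ≤ b ^ 2 * R ^ 2 := by
  have hD := auxD_int b R q hq hs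
  have hDs := auxD_supp b R q hs
  have hDD := auxD_int b R _ hD hDs
  have hDDs := auxD_supp b R _ hDs
  set W1 : EuclideanSpace ℝ (Fin n) → EuclideanSpace ℝ (Fin n) →L[ℝ] ℝ :=
    fun x => ∫ y, Real.exp (b * inner ℝ x y) • auxD b q y with hW1
  set W2 : EuclideanSpace ℝ (Fin n) → EuclideanSpace ℝ (Fin n) →L[ℝ]
      EuclideanSpace ℝ (Fin n) →L[ℝ] ℝ :=
    fun x => ∫ y, Real.exp (b * inner ℝ x y) • auxD b (auxD b q) y with hW2
  have d1 : ∀ x, HasFDerivAt Z (W1 x) x := fun x => by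
    rw [hZ]; exact aux_deriv b R q hq hs x
  have d2 : ∀ x, HasFDerivAt W1 (W2 x) x := fun x => aux_deriv b R _ hD hDs x
  refine ⟨fun x => (Z x)⁻¹ • W1 x,
    fun x => (Z x)⁻¹ • W2 x + (-(Z x ^ 2)⁻¹ • W1 x).smulRight (W1 x), ?_, ?_, ?_⟩
  · intro x
    exact (d1 x).log (hpos x).ne'
  · intro x
    have hi : HasFDerivAt (fun x => (Z x)⁻¹) (-(Z x ^ 2)⁻¹ • W1 x) x :=
      (hasDerivAt_inv (hpos x).ne').comp_hasFDerivAt x (d1 x)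
    exact hi.smul (d2 x)
  · intro x
    have i0 := aux_int b R q hq hs x
    have i1 := aux_int b R _ hD hDs x
    have i2 := aux_int b R _ hDD hDDs x
    have f1 : ∀ u, W1 x u = ∫ y, Real.exp (b * inner ℝ x y) * q y * (b * inner ℝ y u) := by
      intro u
      rw [hW1]
      simp only
      rw [ContinuousLinearMap.integral_apply i1]
      refine integral_congr_ae (Eventually.of_forall fun y => ?_)
      simp [auxD]; ring
    have f2 : ∀ u v, W2 x u v = ∫ y, Real.exp (b * inner ℝ x y) * q y *
        ((b * inner ℝ y u) * (b * inner ℝ y v)) := by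
      intro u v
      rw [hW2]
      simp only
      rw [ContinuousLinearMap.integral_apply i2, ContinuousLinearMap.integral_apply]
      · refine integral_congr_ae (Eventually.of_forall fun y => ?_)
        simp [auxD]; ring
      · exact i2.apply_continuousLinearMap u
    have f0 : Z x = ∫ y, Real.exp (b * inner ℝ x y) * q y := by rw [hZ]; rfl
    have j0 : Integrable (fun y => Real.exp (b * inner ℝ x y) * q y) := i0
    have j1 : ∀ u, Integrable
        (fun y => Real.exp (b * inner ℝ x y) * q y * (b * inner ℝ y u)) := by
      intro u
      refine (i1.apply_continuousLinearMap u).congr (Eventually.of_forall fun y => ?_)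
      simp [auxD]; ring
    have j2 : ∀ u, Integrable (fun y => Real.exp (b * inner ℝ x y) * q y *
        ((b * inner ℝ y u) * (b * inner ℝ y u))) := by
      intro u
      refine ((i2.apply_continuousLinearMap u).apply_continuousLinearMap u).congr
        (Eventually.of_forall fun y => ?_)
      simp [auxD]; ring
    have hz := hpos x
    refine aux_bilin _ _ (by positivity) ?_ ?_ ?_
    · intro u v
      have : W2 x u v = W2 x v u := by
        rw [f2, f2]
        refine integral_congr_ae (Eventually.of_forall fun y => ?_)
        simp only; ring
      simp [this]; ring
    · intro u
      have hm : 0 ≤ ∫ y, Real.exp (b * inner ℝ x y) * q y *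
          (b * inner ℝ y u - W1 x u / Z x) ^ 2 :=
        integral_nonneg fun y => mul_nonneg (mul_nonneg (Real.exp_pos _).le (hq0 y)) (sq_nonneg _)
      have he : ∫ y, Real.exp (b * inner ℝ x y) * q y * (b * inner ℝ y u - W1 x u / Z x) ^ 2
          = W2 x u u - 2 * (W1 x u / Z x) * W1 x u + (W1 x u / Z x) ^ 2 * Z x := by
        generalize W1 x u / Z x = m
        rw [f2, f1, f0, ← integral_const_mul, ← integral_const_mul, ← integral_sub, ← integral_add]
        · refine integral_congr_ae (Eventually.of_forall fun y => ?_)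
          simp only; ring
        · exact (j2 u).sub ((j1 u).const_mul _)
        · exact j0.const_mul _
        · exact j2 u
        · exact (j1 u).const_mul _
      rw [he] at hm
      have : ((Z x)⁻¹ • W2 x + (-(Z x ^ 2)⁻¹ • W1 x).smulRight (W1 x)) u u
          = (Z x)⁻¹ * (W2 x u u - 2 * (W1 x u / Z x) * W1 x u + (W1 x u / Z x) ^ 2 * Z x) := by
        simp; field_simp; ring
      rw [this]
      positivity
    · intro u
      have hle : W2 x u u ≤ b ^ 2 * R ^ 2 * ‖u‖ ^ 2 * Z x := by
        rw [f2, f0, ← integral_const_mul]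
        refine integral_mono (j2 u) (j0.const_mul _) fun y => ?_
        simp only
        by_cases hy : q y = 0
        · simp [hy]
        have hyR : ‖y‖ ≤ R := by simpa using hs hy
        have hR : 0 ≤ R := (norm_nonneg y).trans hyR
        have hw : 0 ≤ Real.exp (b * inner ℝ x y) * q y :=
          mul_nonneg (Real.exp_pos _).le (hq0 y)
        have hin : (inner ℝ y u) ^ 2 ≤ R ^ 2 * ‖u‖ ^ 2 := by
          rw [← mul_pow]
          refine sq_le_sq' ?_ ?_
          · have := (abs_le.1 (abs_real_inner_le_norm y u)).1
            have h2 : ‖y‖ * ‖u‖ ≤ R * ‖u‖ := by gcongr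
            linarith
          · have := (abs_le.1 (abs_real_inner_le_norm y u)).2
            have h2 : ‖y‖ * ‖u‖ ≤ R * ‖u‖ := by gcongr
            linarith
        have h3 := mul_le_mul_of_nonneg_left hin (mul_nonneg hw (sq_nonneg b))
        linarith
      have : ((Z x)⁻¹ • W2 x + (-(Z x ^ 2)⁻¹ • W1 x).smulRight (W1 x)) u u
          = (Z x)⁻¹ * W2 x u u - (W1 x u / Z x) ^ 2 := by
        simp; field_simp; ring
      rw [this]
      have h4 : (Z x)⁻¹ * W2 x u u ≤ b ^ 2 * R ^ 2 * ‖u‖ ^ 2 := by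
        rw [inv_mul_le_iff₀ hz]; linarith
      nlinarith [sq_nonneg (W1 x u / Z x)]

end aux

/-- Lemma (compact support): if `p_H` is supported in the closed ball of radius `R`,
then for every `t > 0` the VP marginal is positive, `log p_t` is twice differentiable,
and the operator norm of its Hessian is bounded by
`1 + e^{-t}/(1-e^{-t})² · R² + e^{-t}/(1-e^{-t})`. -/
theorem stmt_4 (n : ℕ) (R : ℝ) (pH : EuclideanSpace ℝ (Fin n) → ℝ)
    (hnn : ∀ x, 0 ≤ pH x) (hint : Integrable pH) (hmass : ∫ x, pH x = 1)
    (hsupp : Function.support pH ⊆ Metric.closedBall 0 R) :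
    ∀ t > (0 : ℝ),
      (∀ x, 0 < vpMarginal n pH t x) ∧
      TwiceDiff (fun x => Real.log (vpMarginal n pH t x)) ∧
      ∀ x, ‖hessian (fun z => Real.log (vpMarginal n pH t z)) x‖ ≤
        1 + Real.exp (-t) / (1 - Real.exp (-t)) ^ 2 * R ^ 2 +
          Real.exp (-t) / (1 - Real.exp (-t)) := by
  intro t ht
  set s : ℝ := 1 - Real.exp (-t) with hs_def
  have hs : 0 < s := by
    have : Real.exp (-t) < 1 := by rw [Real.exp_lt_one_iff]; linarith
    linarith
  set a : ℝ := Real.exp (-t / 2) with ha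
  have haa : a ^ 2 = Real.exp (-t) := by
    rw [ha, ← Real.exp_nat_mul]; congr 1; push_cast; ring
  set q : EuclideanSpace ℝ (Fin n) → ℝ := fun y => pH y * Real.exp (-(a ^ 2 * ‖y‖ ^ 2) / (2 * s))
    with hq_def
  have hq0 : ∀ y, 0 ≤ q y := fun y => mul_nonneg (hnn y) (Real.exp_pos _).le
  have hqsupp' : Function.support q = Function.support pH := by
    ext y; simp [hq_def, (Real.exp_pos _).ne']
  have hqsupp : Function.support q ⊆ Metric.closedBall 0 R := hqsupp' ▸ hsupp
  have hq : Integrable q := by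
    refine hint.mono ?_ (Eventually.of_forall fun y => ?_)
    · have : Continuous fun y : EuclideanSpace ℝ (Fin n) =>
          Real.exp (-(a ^ 2 * ‖y‖ ^ 2) / (2 * s)) := by fun_prop
      exact hint.1.mul this.aestronglyMeasurable
    · rw [hq_def, norm_mul, Real.norm_eq_abs (Real.exp _), Real.abs_exp]
      refine mul_le_of_le_one_right (norm_nonneg _) ?_
      rw [Real.exp_le_one_iff, neg_div, neg_nonpos]
      positivity
  set Z : EuclideanSpace ℝ (Fin n) → ℝ := fun x => ∫ y, Real.exp (a / s * inner ℝ x y) • q y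
    with hZ
  have hmpos : 0 < volume (Function.support pH) := by
    rw [← integral_pos_iff_support_of_nonneg hnn hint, hmass]; exact one_pos
  have hZpos : ∀ x, 0 < Z x := by
    intro x
    rw [hZ]
    simp only
    rw [integral_pos_iff_support_of_nonneg _ (aux_int (a / s) R q hq hqsupp x)]
    · convert hmpos using 2
      rw [← hqsupp']
      ext y; simp [(Real.exp_pos _).ne']
    · intro y; exact mul_nonneg (Real.exp_pos _).le (hq0 y)
  set c : ℝ := (2 * π * s) ^ (-(n : ℝ) / 2) with hc
  have hcpos : 0 < c := by rw [hc]; positivity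
  have hform : ∀ x, vpMarginal n pH t x = c * Real.exp (-‖x‖ ^ 2 / (2 * s)) * Z x := by
    intro x
    rw [vpMarginal, if_neg ht.ne', hZ]
    simp only
    rw [← integral_const_mul]
    refine integral_congr_ae (Eventually.of_forall fun y => ?_)
    simp only [gaussKernel, hq_def, smul_eq_mul]
    rw [← hs_def, ← ha, ← hc]
    have : Real.exp (-‖x - a • y‖ ^ 2 / (2 * s)) = Real.exp (-‖x‖ ^ 2 / (2 * s)) *
        Real.exp (a / s * inner ℝ x y) * Real.exp (-(a ^ 2 * ‖y‖ ^ 2) / (2 * s)) := by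
      rw [← Real.exp_add, ← Real.exp_add, norm_sub_sq_real, inner_smul_right, norm_smul,
        mul_pow, Real.norm_eq_abs, sq_abs]
      congr 1
      field_simp
      ring
    rw [this]; ring
  have hlog : (fun x => Real.log (vpMarginal n pH t x)) =
      fun x => Real.log c + (-(2 * s)⁻¹) * ‖x‖ ^ 2 + Real.log (Z x) := by
    funext x
    rw [hform, Real.log_mul (by positivity) (hZpos x).ne', Real.log_mul hcpos.ne'
      (Real.exp_pos _).ne', Real.log_exp]
    congr 2
    field_simp
  obtain ⟨Z1, Z2, h1, h2, h3⟩ := aux_main (a / s) R q hq0 hq hqsupp Z hZ hZpos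
  obtain ⟨I, hI_def⟩ : ∃ I : EuclideanSpace ℝ (Fin n) →L[ℝ] EuclideanSpace ℝ (Fin n) →L[ℝ] ℝ,
      ∀ x, I x = innerSL ℝ x := ⟨innerSL ℝ, fun _ => rfl⟩
  have D1 : ∀ x, HasFDerivAt (fun x => Real.log (vpMarginal n pH t x))
      ((-s⁻¹) • I x + Z1 x) x := by
    intro x
    rw [hlog]
    have h := (((hasStrictFDerivAt_norm_sq x).hasFDerivAt.const_mul (-(2 * s)⁻¹)).const_add
      (Real.log c)).add (h1 x)
    refine h.congr_fderiv ?_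
    ext v
    simp [hI_def]
    field_simp
  have D1' : fderiv ℝ (fun x => Real.log (vpMarginal n pH t x)) =
      fun x => (-s⁻¹) • I x + Z1 x := funext fun x => (D1 x).fderiv
  have D2 : ∀ x, HasFDerivAt (fderiv ℝ (fun x => Real.log (vpMarginal n pH t x)))
      ((-s⁻¹) • I + Z2 x) x := by
    intro x
    rw [D1']
    exact ((I.hasFDerivAt (x := x)).const_smul
      (-s⁻¹)).add (h2 x)
  refine ⟨fun x => ?_, ⟨fun x => (D1 x).differentiableAt, fun x => (D2 x).differentiableAt⟩,
    fun x => ?_⟩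
  · rw [hform]; have := hZpos x; positivity
  · rw [hessian, (D2 x).fderiv]
    have hI : ‖(-s⁻¹) • I‖ ≤ s⁻¹ := by
      refine ContinuousLinearMap.opNorm_le_bound _ (by positivity) fun u => ?_
      simp [hI_def, norm_smul, abs_of_pos hs]
    have hadd : ‖(-s⁻¹) • I + Z2 x‖ ≤ ‖(-s⁻¹) • I‖ + ‖Z2 x‖ :=
      ContinuousLinearMap.opNorm_add_le _ _
    refine hadd.trans ((add_le_add hI (h3 x)).trans (le_of_eq ?_))
    rw [div_pow, haa]
    have : Real.exp (-t) = 1 - s := by rw [hs_def]; ring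
    rw [this]
    field_simp
    ring
end

section
/- Let V : ℝ^n → ℝ be twice continuously differentiable with positive semidefinite Hessian ∇²V(x) ⪰ 0 for all x, suppose e^{-V} is Lebesgue integrable with Z = ∫ e^{-V(x)} dx > 0, and let p_H = e^{-V}/Z be the resulting (log-concave) probability density. Then for every t > 0 the VP marginal p_t is strictly positive, log p_t is twice differentiable, and for all x ∈ ℝ^n the operator norm of the Hessian satisfies ‖∇² log p_t(x)‖ ≤ 2/(1 − e^{-t}). -/
open MeasureTheory Real Filter Set
open scoped ENNReal Topology RealInnerProductSpace Classical

lemma BM_compact (K L C : Set ℝ) (hK : IsCompact K) (hL : IsCompact L) (nK : K.Nonempty)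
    (nL : L.Nonempty) (h : ∀ x ∈ K, ∀ y ∈ L, (2:ℝ)⁻¹ * (x + y) ∈ C) :
    volume K + volume L ≤ 2 * volume C := by
  set D : Set ℝ := (fun z => (2:ℝ)⁻¹ * z) ⁻¹' C with hD
  have hvol : volume D = 2 * volume C := by
    rw [hD, Real.volume_preimage_mul_left (by norm_num)]
    norm_num
  rw [← hvol]
  set a := sSup K
  set b := sInf L
  have haK : a ∈ K := hK.sSup_mem nK
  have hbL : b ∈ L := hL.sInf_mem nL
  have h1 : volume ((fun z => z + (-b)) ⁻¹' K) = volume K := measure_preimage_add_right _ _ _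
  have h2 : volume ((fun z => z + (-a)) ⁻¹' L \ {a + b}) = volume L := by
    rw [measure_sdiff_null (by simp)]
    exact measure_preimage_add_right _ _ _
  rw [← h1, ← h2, ← measure_union']
  · apply measure_mono
    rintro z (hz | ⟨hz, -⟩)
    · have := h _ hz _ hbL
      simpa [hD] using this
    · have := h _ haK _ hz
      simpa [hD] using this
  · rw [Set.disjoint_left]
    rintro z hz ⟨hz2, hz3⟩
    have e1 := le_csSup hK.bddAbove hz
    have e2 := csInf_le hL.bddBelow hz2
    apply hz3
    simp only [Set.mem_singleton_iff]
    change z + -b ≤ a at e1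
    change b ≤ z + -a at e2
    linarith
  · exact (measurable_id.add_const _) hK.measurableSet

lemma ennreal_add_le_of_forall_lt' {a b c : ℝ≥0∞} (ha : ∀ r < a, r + b ≤ c) (h0 : b ≤ c) :
    a + b ≤ c := by
  rcases eq_or_ne b ⊤ with rfl | hb
  · simpa using h0
  have : a ≤ c - b := le_of_forall_lt fun r hr => by
    obtain ⟨r', h1, h2⟩ := exists_between hr
    exact h1.trans_le (ENNReal.le_sub_of_add_le_right hb (ha _ h2))
  calc a + b ≤ c - b + b := by gcongr
    _ = c := tsub_add_cancel_of_le h0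

lemma BM_meas (A B C : Set ℝ) (hA : MeasurableSet A) (hB : MeasurableSet B) (nA : A.Nonempty)
    (nB : B.Nonempty) (h : ∀ x ∈ A, ∀ y ∈ B, (2:ℝ)⁻¹ * (x + y) ∈ C) :
    volume A + volume B ≤ 2 * volume C := by
  obtain ⟨a, ha⟩ := nA
  obtain ⟨b, hb⟩ := nB
  have key : ∀ K L : Set ℝ, K ⊆ A → L ⊆ B → IsCompact K → IsCompact L →
      volume K + volume L ≤ 2 * volume C := by
    intro K L hKA hLB hK hL
    have := BM_compact (insert a K) (insert b L) C (hK.insert a) (hL.insert b) ⟨a, by simp⟩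
      ⟨b, by simp⟩ (fun x hx y hy => h x (Set.insert_subset ha hKA hx) y (Set.insert_subset hb hLB hy))
    refine le_trans ?_ this
    gcongr <;> simp
  have key2 : ∀ L : Set ℝ, L ⊆ B → IsCompact L → volume A + volume L ≤ 2 * volume C := by
    intro L hLB hL
    apply ennreal_add_le_of_forall_lt'
    · intro r hr
      obtain ⟨K, hKA, hK, hrK⟩ := hA.exists_lt_isCompact hr
      exact (by gcongr : r + volume L ≤ volume K + volume L).trans (key K L hKA hLB hK hL)
    · simpa using key ∅ L (by simp) hLB isCompact_empty hL
  rw [add_comm]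
  apply ennreal_add_le_of_forall_lt'
  · intro r hr
    obtain ⟨K, hKA, hK, hrK⟩ := hB.exists_lt_isCompact hr
    rw [add_comm]
    exact (by gcongr : volume A + r ≤ volume A + volume K).trans (key2 K hKA hK)
  · simpa using key2 ∅ (by simp) isCompact_empty

lemma PL_norm (f g h : ℝ → ℝ) (hf : Measurable f) (hg : Measurable g) (hh : Measurable h)
    (f0 : ∀ x, 0 ≤ f x) (g0 : ∀ x, 0 ≤ g x) (h0 : ∀ x, 0 ≤ h x)
    (f1 : ∀ x, f x ≤ 1) (g1 : ∀ x, g x ≤ 1)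
    (fs : ∀ s < 1, ∃ x, s < f x) (gs : ∀ s < 1, ∃ x, s < g x)
    (H : ∀ x y, f x * g y ≤ h ((2:ℝ)⁻¹ * (x + y)) ^ 2) :
    (∫⁻ x, ENNReal.ofReal (f x)) + (∫⁻ x, ENNReal.ofReal (g x)) ≤
      2 * ∫⁻ x, ENNReal.ofReal (h x) := by
  rw [lintegral_eq_lintegral_meas_lt _ (ae_of_all _ f0) hf.aemeasurable,
    lintegral_eq_lintegral_meas_lt _ (ae_of_all _ g0) hg.aemeasurable,
    lintegral_eq_lintegral_meas_lt _ (ae_of_all _ h0) hh.aemeasurable]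
  have anti : ∀ k : ℝ → ℝ, Measurable fun t => volume {a | t < k a} := fun k =>
    Antitone.measurable fun s t hst => measure_mono fun a (ha : t < k a) => lt_of_le_of_lt hst ha
  rw [← lintegral_add_left (anti f), ← lintegral_const_mul _ (anti h)]
  apply setLIntegral_mono ((anti h).const_mul _)
  intro t (ht : 0 < t)
  by_cases ht1 : t < 1
  · apply BM_meas _ _ _ (measurableSet_lt measurable_const hf)
      (measurableSet_lt measurable_const hg) (fs t ht1) (gs t ht1)
    intro x (hx : t < f x) y (hy : t < g y)
    have := H x y
    change t < h _
    have h2 : t ^ 2 < h ((2:ℝ)⁻¹ * (x + y)) ^ 2 := by nlinarith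
    exact lt_of_pow_lt_pow_left₀ 2 (h0 _) h2
  · have e1 : {a | t < f a} = ∅ := by
      ext a; simp; linarith [f1 a]
    have e2 : {a | t < g a} = ∅ := by
      ext a; simp; linarith [g1 a]
    simp [e1, e2]

lemma ennreal_four_mul_le (a b : ℝ≥0∞) : 4 * (a * b) ≤ (a + b) ^ 2 := by
  rcases le_total a b with h | h
  · obtain ⟨d, rfl⟩ := exists_add_of_le h
    calc 4 * (a * (a + d)) ≤ 4 * (a * (a + d)) + d ^ 2 := le_self_add
      _ = _ := by ring
  · obtain ⟨d, rfl⟩ := exists_add_of_le h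
    calc 4 * ((b + d) * b) ≤ 4 * ((b + d) * b) + d ^ 2 := le_self_add
      _ = _ := by ring

lemma PL_bdd (f g h : ℝ → ℝ) (hf : Measurable f) (hg : Measurable g) (hh : Measurable h)
    (f0 : ∀ x, 0 ≤ f x) (g0 : ∀ x, 0 ≤ g x) (h0 : ∀ x, 0 ≤ h x) (k : ℝ)
    (f1 : ∀ x, f x ≤ k) (g1 : ∀ x, g x ≤ k)
    (H : ∀ x y, f x * g y ≤ h ((2:ℝ)⁻¹ * (x + y)) ^ 2) :
    (∫⁻ x, ENNReal.ofReal (f x)) * (∫⁻ x, ENNReal.ofReal (g x)) ≤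
      (∫⁻ x, ENNReal.ofReal (h x)) ^ 2 := by
  have bf : BddAbove (Set.range f) := ⟨k, by rintro _ ⟨x, rfl⟩; exact f1 x⟩
  have bg : BddAbove (Set.range g) := ⟨k, by rintro _ ⟨x, rfl⟩; exact g1 x⟩
  by_cases hfz : ∀ x, f x = 0
  · simp [hfz]
  by_cases hgz : ∀ x, g x = 0
  · simp [hgz]
  push Not at hfz hgz
  obtain ⟨x0, hx0⟩ := hfz
  obtain ⟨y0, hy0⟩ := hgz
  set M := sSup (Set.range f)
  set N := sSup (Set.range g)
  have lf : ∀ x, f x ≤ M := fun x => le_csSup bf ⟨x, rfl⟩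
  have lg : ∀ x, g x ≤ N := fun x => le_csSup bg ⟨x, rfl⟩
  have Mp : 0 < M := lt_of_lt_of_le (lt_of_le_of_ne (f0 x0) (Ne.symm hx0)) (lf x0)
  have Np : 0 < N := lt_of_lt_of_le (lt_of_le_of_ne (g0 y0) (Ne.symm hy0)) (lg y0)
  have MN : 0 < M * N := mul_pos Mp Np
  have sp : 0 < √(M * N) := Real.sqrt_pos.2 MN
  have main := PL_norm (fun x => M⁻¹ * f x) (fun x => N⁻¹ * g x) (fun x => (√(M * N))⁻¹ * h x)
    (hf.const_mul _) (hg.const_mul _) (hh.const_mul _)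
    (fun x => mul_nonneg (by positivity) (f0 x)) (fun x => mul_nonneg (by positivity) (g0 x))
    (fun x => mul_nonneg (by positivity) (h0 x))
    (fun x => by rw [inv_mul_le_iff₀ Mp]; simpa using lf x)
    (fun x => by rw [inv_mul_le_iff₀ Np]; simpa using lg x)
    (fun s hs => by
      obtain ⟨_, ⟨x, rfl⟩, hx⟩ := exists_lt_of_lt_csSup (Set.range_nonempty f)
        (show M * s < M by nlinarith)
      exact ⟨x, by rwa [lt_inv_mul_iff₀ Mp]⟩)
    (fun s hs => by
      obtain ⟨_, ⟨x, rfl⟩, hx⟩ := exists_lt_of_lt_csSup (Set.range_nonempty g)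
        (show N * s < N by nlinarith)
      exact ⟨x, by rwa [lt_inv_mul_iff₀ Np]⟩)
    (fun x y => by
      rw [mul_pow, inv_pow, Real.sq_sqrt MN.le, mul_inv]
      have := mul_le_mul_of_nonneg_left (H x y) (show 0 ≤ M⁻¹ * N⁻¹ by positivity)
      calc _ = M⁻¹ * N⁻¹ * (f x * g y) := by ring
        _ ≤ _ := this)
  have conv : ∀ (c : ℝ) (_ : 0 < c) (u : ℝ → ℝ), Measurable u →
      ∫⁻ x, ENNReal.ofReal (c⁻¹ * u x) = ENNReal.ofReal c⁻¹ * ∫⁻ x, ENNReal.ofReal (u x) := by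
    intro c hc u hu
    rw [← lintegral_const_mul _ hu.ennreal_ofReal]
    congr with x
    rw [ENNReal.ofReal_mul (by positivity)]
  rw [conv M Mp f hf, conv N Np g hg, conv _ sp h hh] at main
  set I := ∫⁻ x, ENNReal.ofReal (f x)
  set J := ∫⁻ x, ENNReal.ofReal (g x)
  set L := ∫⁻ x, ENNReal.ofReal (h x)
  have h4 := (ennreal_four_mul_le _ _).trans (pow_le_pow_left₀ (by positivity) main 2)
  have e1 : ENNReal.ofReal (√(M * N))⁻¹ ^ 2 = ENNReal.ofReal M⁻¹ * ENNReal.ofReal N⁻¹ := by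
    rw [← ENNReal.ofReal_pow (by positivity), inv_pow, Real.sq_sqrt MN.le, mul_inv,
      ENNReal.ofReal_mul (by positivity)]
  have e2 : (4 * (ENNReal.ofReal M⁻¹ * ENNReal.ofReal N⁻¹)) * (I * J) ≤
      (4 * (ENNReal.ofReal M⁻¹ * ENNReal.ofReal N⁻¹)) * L ^ 2 := by
    calc _ = 4 * (ENNReal.ofReal M⁻¹ * I * (ENNReal.ofReal N⁻¹ * J)) := by ring
      _ ≤ _ := h4
      _ = 4 * (ENNReal.ofReal (√(M * N))⁻¹ ^ 2) * L ^ 2 := by ring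
      _ = _ := by rw [e1]
  refine (ENNReal.mul_le_mul_iff_right ?_ ?_).1 e2
  · have : 0 < M⁻¹ := by positivity
    have : 0 < N⁻¹ := by positivity
    simp [*]
  · finiteness

/-- midpoint Prékopa–Leindler property of a measure space -/
def PLprop (E : Type*) [AddCommGroup E] [Module ℝ E] [MeasureSpace E] : Prop :=
  ∀ f g h : E → ℝ≥0∞, Measurable f → Measurable g → Measurable h →
    (∀ x y, f x * g y ≤ h ((2:ℝ)⁻¹ • (x + y)) ^ 2) →
    (∫⁻ x, f x) * (∫⁻ x, g x) ≤ (∫⁻ x, h x) ^ 2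

lemma lintegral_trunc (f : ℝ → ℝ≥0∞) (hf : Measurable f) :
    ∫⁻ x, f x = ⨆ k : ℕ, ∫⁻ x, min (f x) k := by
  rw [← lintegral_iSup]
  · congr with x
    apply le_antisymm
    · apply le_of_forall_lt
      intro c hc
      obtain ⟨k, hk⟩ := ENNReal.exists_nat_gt (hc.ne_top)
      exact lt_of_lt_of_le (lt_min hc hk) (le_iSup (fun k : ℕ => min (f x) (k : ℝ≥0∞)) k)
    · exact iSup_le fun k => min_le_left _ _
  · intro k; exact hf.min measurable_const
  · intro k l hkl x
    dsimp
    gcongr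

lemma PL_real : PLprop ℝ := by
  intro f g h hf hg hh H
  have fin : ∀ (u : ℝ → ℝ≥0∞) (k : ℕ) x, min (u x) k ≠ ⊤ := fun u k x =>
    ne_top_of_le_ne_top (ENNReal.natCast_ne_top k) (min_le_right _ _)
  have key : ∀ k : ℕ, (∫⁻ x, min (f x) k) * (∫⁻ x, min (g x) k) ≤ (∫⁻ x, h x) ^ 2 := by
    intro k
    have := PL_bdd (fun x => (min (f x) k).toReal) (fun x => (min (g x) k).toReal)
      (fun x => (min (h x) k).toReal)
      (hf.min measurable_const).ennreal_toReal (hg.min measurable_const).ennreal_toReal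
      (hh.min measurable_const).ennreal_toReal (fun _ => ENNReal.toReal_nonneg)
      (fun _ => ENNReal.toReal_nonneg) (fun _ => ENNReal.toReal_nonneg) k
      (fun x => by
        have := ENNReal.toReal_mono (ENNReal.natCast_ne_top k) (min_le_right (f x) k)
        simpa using this)
      (fun x => by
        have := ENNReal.toReal_mono (ENNReal.natCast_ne_top k) (min_le_right (g x) k)
        simpa using this)
      (fun x y => by
        rw [← ENNReal.toReal_mul, ← ENNReal.toReal_pow]
        apply ENNReal.toReal_mono (ENNReal.pow_ne_top (fin _ _ _))
        rcases min_choice (h ((2:ℝ)⁻¹ * (x + y))) (k : ℝ≥0∞) with e | e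
        · rw [e]
          exact (mul_le_mul' (min_le_left _ _) (min_le_left _ _)).trans (H x y)
        · rw [e, sq]
          exact mul_le_mul' (min_le_right _ _) (min_le_right _ _))
    simp only [ENNReal.ofReal_toReal (fin _ _ _)] at this
    refine this.trans ?_
    gcongr with x
    exact min_le_left _ _
  rw [lintegral_trunc f hf, lintegral_trunc g hg, ENNReal.iSup_mul]
  refine iSup_le fun k => ?_
  rw [ENNReal.mul_iSup]
  refine iSup_le fun l => ?_
  refine le_trans ?_ (key (max k l))
  gcongr
  · exact le_max_left _ _
  · exact le_max_right _ _

lemma PL_prod {E F : Type*} [AddCommGroup E] [Module ℝ E] [MeasureSpace E]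
    [AddCommGroup F] [Module ℝ F] [MeasureSpace F] [SFinite (volume : Measure E)]
    [SFinite (volume : Measure F)] (hE : PLprop E) (hF : PLprop F) : PLprop (E × F) := by
  intro f g h hf hg hh H
  rw [Measure.volume_eq_prod, lintegral_prod _ hf.aemeasurable, lintegral_prod _ hg.aemeasurable,
    lintegral_prod _ hh.aemeasurable]
  apply hE _ _ _ hf.lintegral_prod_right' hg.lintegral_prod_right' hh.lintegral_prod_right'
  intro x y
  apply hF _ _ _ (hf.comp measurable_prodMk_left) (hg.comp measurable_prodMk_left)
    (hh.comp measurable_prodMk_left)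
  intro u v
  exact H (x, u) (y, v)

lemma PL_transfer {E F : Type*} [AddCommGroup E] [Module ℝ E] [MeasureSpace E]
    [AddCommGroup F] [Module ℝ F] [MeasureSpace F] (hE : PLprop E) (e : E → F)
    (he : MeasurePreserving e) (hlin : ∀ x y, e ((2:ℝ)⁻¹ • (x + y)) = (2:ℝ)⁻¹ • (e x + e y)) :
    PLprop F := by
  intro f g h hf hg hh H
  rw [← he.lintegral_comp hf, ← he.lintegral_comp hg, ← he.lintegral_comp hh]
  apply hE _ _ _ (hf.comp he.measurable) (hg.comp he.measurable) (hh.comp he.measurable)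
  intro x y
  have := H (e x) (e y)
  rwa [← hlin] at this

lemma PL_pi : ∀ n : ℕ, PLprop (Fin n → ℝ)
  | 0 => by
    intro f g h hf hg hh H
    have := H 0 0
    rw [Measure.volume_pi_eq_dirac 0]
    simpa using this
  | n + 1 => by
    have ih := PL_pi n
    have h2 := PL_prod PL_real ih
    refine PL_transfer h2 _
      ((volume_preserving_piFinSuccAbove (fun _ : Fin (n + 1) => ℝ) 0).symm _) ?_
    intro x y
    ext i
    refine Fin.cases ?_ (fun j => ?_) i <;> (simp [MeasurableEquiv.piFinSuccAbove]; ring)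

lemma PL_euclidean (n : ℕ) : PLprop (EuclideanSpace ℝ (Fin n)) :=
  PL_transfer (PL_pi n) _ (PiLp.volume_preserving_toLp (Fin n)) fun x y => by simp

section hesscalc
variable {E : Type*} [NormedAddCommGroup E] [InnerProductSpace ℝ E]

lemma line_deriv2 (φ : E → ℝ) (h : TwiceDiff φ) (x u : E) (r : ℝ) :
    HasDerivAt (fun r : ℝ => φ (x + r • u)) (fderiv ℝ φ (x + r • u) u) r ∧
    HasDerivAt (fun r : ℝ => fderiv ℝ φ (x + r • u) u) (hessian φ (x + r • u) u u) r := by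
  have hl : HasDerivAt (fun r : ℝ => x + r • u) u r := by
    simpa using ((hasDerivAt_id r).smul_const u).const_add x
  refine ⟨(h.1 _).hasFDerivAt.comp_hasDerivAt r hl, ?_⟩
  have := (h.2 (x + r • u)).hasFDerivAt.comp_hasDerivAt r hl
  have h2 := this.clm_apply (hasDerivAt_const r u)
  simpa [hessian] using h2

lemma hess_lower (φ : E → ℝ) (h : TwiceDiff φ) (c : ℝ) (x u : E)
    (hc : ∀ u, 2 * φ x ≤ φ (x + u) + φ (x - u) + c * ‖u‖ ^ 2) :
    - c * ‖u‖ ^ 2 ≤ hessian φ x u u := by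
  by_contra! hlt
  set G : ℝ → ℝ := fun r => φ (x + r • u) + φ (x + r • (-u)) + c * ‖u‖ ^ 2 * r ^ 2 with hG
  have d1 : ∀ r, HasDerivAt G (fderiv ℝ φ (x + r • u) u + fderiv ℝ φ (x + r • (-u)) (-u)
      + c * ‖u‖ ^ 2 * (2 * r)) r := by
    intro r
    have := ((line_deriv2 φ h x u r).1.add (line_deriv2 φ h x (-u) r).1).add
      ((hasDerivAt_pow 2 r).const_mul (c * ‖u‖ ^ 2))
    refine HasDerivAt.congr_deriv (f := G) this ?_
    simp
  have e1 : deriv G = fun r => fderiv ℝ φ (x + r • u) u + fderiv ℝ φ (x + r • (-u)) (-u)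
      + c * ‖u‖ ^ 2 * (2 * r) := funext fun r => (d1 r).deriv
  have d2 : HasDerivAt (deriv G) (2 * hessian φ x u u + 2 * (c * ‖u‖ ^ 2)) 0 := by
    rw [e1]
    have := ((line_deriv2 φ h x u 0).2.add (line_deriv2 φ h x (-u) 0).2).add
      (((hasDerivAt_id (0:ℝ)).const_mul 2).const_mul (c * ‖u‖ ^ 2))
    refine HasDerivAt.congr_deriv (f := fun r => fderiv ℝ φ (x + r • u) u +
      fderiv ℝ φ (x + r • (-u)) (-u) + c * ‖u‖ ^ 2 * (2 * r)) this ?_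
    simp
    ring
  have neg : deriv (deriv G) 0 < 0 := by rw [d2.deriv]; linarith
  have hmax := isLocalMax_of_deriv_deriv_neg neg (by rw [e1]; simp) (d1 0).continuousAt
  have hmin : ∀ r, G 0 ≤ G r := by
    intro r
    have := hc (r • u)
    simp only [hG, zero_smul, add_zero, smul_neg, ← sub_eq_add_neg]
    rw [norm_smul, mul_pow, Real.norm_eq_abs, sq_abs] at this
    simp only [sub_zero]
    nlinarith
  have hev : G =ᶠ[𝓝 0] fun _ => G 0 := by
    filter_upwards [hmax] with r hr
    exact le_antisymm hr (hmin r)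
  have : deriv (deriv G) 0 = 0 := by
    have h1 := hev.deriv.deriv_eq
    simpa using h1
  linarith

lemma mid_convex (φ : E → ℝ) (h : TwiceDiff φ) (hc : ∀ x u, 0 ≤ hessian φ x u u) (m d : E) :
    2 * φ m ≤ φ (m + d) + φ (m - d) := by
  set g : ℝ → ℝ := fun r => φ (m + r • d)
  have e1 : deriv g = fun r => fderiv ℝ φ (m + r • d) d :=
    funext fun r => (line_deriv2 φ h m d r).1.deriv
  have hconv : ConvexOn ℝ univ g := by
    apply convexOn_univ_of_deriv2_nonneg
    · intro r; exact (line_deriv2 φ h m d r).1.differentiableAt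
    · rw [e1]; intro r; exact (line_deriv2 φ h m d r).2.differentiableAt
    · intro r
      simp only [Function.iterate_succ, Function.iterate_zero, Function.comp_apply, id]
      rw [e1, (line_deriv2 φ h m d r).2.deriv]
      exact hc _ _
  have := hconv.2 (mem_univ (1:ℝ)) (mem_univ (-1:ℝ)) (show (0:ℝ) ≤ 1/2 by norm_num)
    (show (0:ℝ) ≤ 1/2 by norm_num) (by norm_num)
  simp [g, ← sub_eq_add_neg] at this
  linarith

lemma hess_norm (φ : E → ℝ) (h : TwiceDiff φ) (x : E) (C : ℝ) (hC : 0 ≤ C)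
    (h1 : ∀ u, hessian φ x u u ≤ 0) (h2 : ∀ u, -C * ‖u‖ ^ 2 ≤ hessian φ x u u) :
    ‖hessian φ x‖ ≤ C := by
  apply ContinuousLinearMap.opNorm_le_bound₂ _ hC
  intro u v
  have symm : hessian φ x u v = hessian φ x v u :=
    second_derivative_symmetric (fun y => (h.1 y).hasFDerivAt) (h.2 x).hasFDerivAt u v
  have hd := discrim_le_zero (a := - hessian φ x v v) (b := -2 * hessian φ x u v)
    (c := - hessian φ x u u) (fun r => by
      have := h1 (u + r • v)
      simp only [map_add, map_smul, add_apply, smul_apply, smul_eq_mul] at this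
      rw [← symm] at this
      nlinarith)
  unfold discrim at hd
  rw [Real.norm_eq_abs]
  apply abs_le_of_sq_le_sq _ (by positivity)
  have a1 := h1 u
  have a2 := h1 v
  have b1 := h2 u
  have b2 := h2 v
  have : (-hessian φ x u u) * (-hessian φ x v v) ≤ (C * ‖u‖^2) * (C * ‖v‖^2) := by
    apply mul_le_mul <;> linarith
  nlinarith


lemma conv_deriv [MeasureSpace E] [BorelSpace E] [SecondCountableTopology E] {G : Type*} [NormedAddCommGroup G] [NormedSpace ℝ G]
    (w : E → ℝ) (hw : Integrable w) (a : ℝ)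
    (K : E → G)
    (K' : E → E →L[ℝ] G)
    (hK : ∀ z, HasFDerivAt K (K' z) z) (hK' : Continuous K') (C C' : ℝ)
    (hC : ∀ z, ‖K z‖ ≤ C) (hC' : ∀ z, ‖K' z‖ ≤ C') (x : E) :
    Integrable (fun y => w y • K (x - a • y)) ∧
    HasFDerivAt (fun x => ∫ y, w y • K (x - a • y)) (∫ y, w y • K' (x - a • y)) x := by
  have Kc : Continuous K := continuous_iff_continuousAt.2 fun z => (hK z).continuousAt
  have m1 : ∀ x, AEStronglyMeasurable (fun y => w y • K (x - a • y)) volume := fun x =>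
    hw.1.smul (Kc.comp (by fun_prop)).aestronglyMeasurable
  have m2 : ∀ x, AEStronglyMeasurable (fun y => w y • K' (x - a • y)) volume := fun x =>
    hw.1.smul (hK'.comp (by fun_prop)).aestronglyMeasurable
  have hI : Integrable (fun y => w y • K (x - a • y)) := by
    refine (hw.norm.mul_const C).mono' (m1 x) (ae_of_all _ fun y => ?_)
    rw [norm_smul]
    exact mul_le_mul_of_nonneg_left (hC _) (norm_nonneg _)
  refine ⟨hI, ?_⟩
  refine hasFDerivAt_integral_of_dominated_of_fderiv_le (s := univ)
    (F' := fun x y => w y • K' (x - a • y)) (bound := fun y => ‖w y‖ * C') univ_mem (Eventually.of_forall m1) hI (m2 x)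
    (ae_of_all _ fun y x _ => ?_) (hw.norm.mul_const C') (ae_of_all _ fun y x _ => ?_)
  · rw [norm_smul]
    exact mul_le_mul_of_nonneg_left (hC' _) (norm_nonneg _)
  · have h1 : HasFDerivAt (fun x => x - a • y) (ContinuousLinearMap.id ℝ _) x :=
      (hasFDerivAt_id x).sub_const _
    have := ((hK (x - a • y)).comp x h1).const_smul (w y)
    rw [ContinuousLinearMap.comp_id] at this
    exact this

/-- real inner product as a continuous bilinear map -/
noncomputable def innB (E : Type*) [NormedAddCommGroup E] [InnerProductSpace ℝ E] :
    E →L[ℝ] E →L[ℝ] ℝ :=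
  LinearMap.mkContinuous₂ (innerₗ (E)) 1 fun x y => by
    simpa using abs_real_inner_le_norm x y

lemma innB_apply  (x y : E) : innB E x y = inner ℝ x y := rfl

lemma innB_norm : ‖innB E‖ ≤ 1 := LinearMap.mkContinuous₂_norm_le _ zero_le_one _

lemma innB_norm'  (z : E) : ‖innB E z‖ ≤ ‖z‖ := by
  simpa using (innB E).le_of_opNorm_le (innB_norm) z

noncomputable def gaussE (c s : ℝ) (z : E) : ℝ := c * Real.exp (-‖z‖ ^ 2 / (2 * s))

set_option maxSynthPendingDepth 3 in
lemma gauss_facts (c s : ℝ) (cpos : 0 < c) (hs : 0 < s) :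
    ∃ (K' : E → E →L[ℝ] ℝ)
      (K'' : E →
        E →L[ℝ] E →L[ℝ] ℝ) (C C' C'' : ℝ),
      (∀ z, HasFDerivAt (gaussE (E := E) c s) (K' z) z) ∧ (∀ z, HasFDerivAt K' (K'' z) z) ∧
      Continuous K'' ∧ (∀ z, ‖gaussE (E := E) c s z‖ ≤ C) ∧ (∀ z, ‖K' z‖ ≤ C') ∧
      (∀ z, ‖K'' z‖ ≤ C'') := by
  have Kpos : ∀ z : E, 0 < gaussE c s z := fun z => by unfold gaussE; positivity
  set K := gaussE (E := E) c s with hKdef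
  set K' : E → E →L[ℝ] ℝ :=
    fun z => (-s⁻¹ * K z) • innB E z with hK'def
  set K'' : E →
        E →L[ℝ] E →L[ℝ] ℝ :=
    fun z => (-s⁻¹ * K z) • innB E + (-s⁻¹ • K' z).smulRight (innB E z) with hK''def
  have hK : ∀ z, HasFDerivAt K (K' z) z := by
    intro z
    have h1 := (hasStrictFDerivAt_norm_sq z).hasFDerivAt
    have h2 := ((h1.const_mul (-(2 * s)⁻¹)).exp).const_mul c
    have e : K = fun z => c * Real.exp (-(2 * s)⁻¹ * ‖z‖ ^ 2) := by
      funext z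
      rw [hKdef]; unfold gaussE
      congr 2
      field_simp
    have ez : K z = c * Real.exp (-(2 * s)⁻¹ * ‖z‖ ^ 2) := congrFun e z
    rw [hK'def]
    simp only [ez]
    rw [e]
    refine h2.congr_fderiv ?_
    ext v
    simp [innB_apply]
    field_simp
  have hK2 : ∀ z, HasFDerivAt K' (K'' z) z := by
    intro z
    exact ((hK z).const_mul (-s⁻¹)).smul (innB E).hasFDerivAt
  have Kc : Continuous K := continuous_iff_continuousAt.2 fun z => (hK z).continuousAt
  have K'c : Continuous K' := continuous_iff_continuousAt.2 fun z => (hK2 z).continuousAt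
  have bK : ∀ z, K z ≤ c := by
    intro z
    have : Real.exp (-‖z‖ ^ 2 / (2 * s)) ≤ 1 := Real.exp_le_one_iff.2 (by
      apply div_nonpos_of_nonpos_of_nonneg <;> [(simp; done); positivity])
    calc K z = c * Real.exp (-‖z‖ ^ 2 / (2 * s)) := rfl
      _ ≤ c * 1 := by gcongr
      _ = c := mul_one c
  have bK2 : ∀ z, K z * ‖z‖ ^ 2 ≤ 2 * s * c := by
    intro z
    set v := ‖z‖ ^ 2 / (2 * s) with hv
    have hz : ‖z‖ ^ 2 = 2 * s * v := by rw [hv]; field_simp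
    have h1 : v * Real.exp (-v) ≤ 1 := by
      have := Real.add_one_le_exp v
      have h2 : Real.exp v * Real.exp (-v) = 1 := by rw [← Real.exp_add]; simp
      have := mul_le_mul_of_nonneg_right (show v ≤ Real.exp v by linarith) (Real.exp_pos (-v)).le
      linarith
    have e : K z = c * Real.exp (-v) := by
      rw [hv, ← neg_div]; rfl
    rw [e, hz]
    calc c * Real.exp (-v) * (2 * s * v) = 2 * s * c * (v * Real.exp (-v)) := by ring
      _ ≤ 2 * s * c * 1 := by gcongr
      _ = _ := mul_one _
  have nK' : ∀ z, ‖K' z‖ ≤ s⁻¹ * (K z * ‖z‖) := by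
    intro z
    rw [hK'def]; simp only
    rw [norm_smul, norm_mul, norm_neg, Real.norm_of_nonneg (Kpos z).le,
      Real.norm_of_nonneg (inv_pos.2 hs).le, mul_assoc]
    gcongr
    · exact (Kpos z).le
    · exact innB_norm' z
  refine ⟨K', K'', c, s⁻¹ * (c + 2 * s * c), s⁻¹ * c + s⁻¹ * (s⁻¹ * (2 * s * c)),
    hK, hK2, ?_, ?_, ?_, ?_⟩
  · rw [hK''def]
    have h1 : Continuous fun z => (-s⁻¹ • K' z).smulRight (innB E z) := by
      have : Continuous fun z => ContinuousLinearMap.smulRightL ℝ (E)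
        (E →L[ℝ] ℝ) (-s⁻¹ • K' z) (innB E z) := by fun_prop
      exact this
    have h2 : Continuous fun z => (-s⁻¹ * K z) • innB E := by fun_prop
    fun_prop
  · intro z
    rw [Real.norm_of_nonneg (Kpos z).le]; exact bK z
  · intro z
    refine (nK' z).trans ?_
    gcongr
    have : ‖z‖ ≤ 1 + ‖z‖ ^ 2 := by nlinarith [sq_nonneg (‖z‖ - 1)]
    nlinarith [Kpos z, bK z, bK2 z]
  · intro z
    refine (norm_add_le ((-s⁻¹ * K z) • innB E) ((-s⁻¹ • K' z).smulRight (innB E z))).trans (add_le_add ?_ ?_)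
    · rw [norm_smul, norm_mul, norm_neg, Real.norm_of_nonneg (Kpos z).le,
        Real.norm_of_nonneg (inv_pos.2 hs).le]
      calc s⁻¹ * K z * ‖innB E‖ ≤ s⁻¹ * K z * 1 := by
            gcongr
            · exact mul_nonneg (by positivity) (Kpos z).le
            · exact innB_norm
        _ = s⁻¹ * K z := mul_one _
        _ ≤ _ := by gcongr; exact bK z
    · rw [ContinuousLinearMap.norm_smulRight_apply, norm_smul, norm_neg,
        Real.norm_of_nonneg (inv_pos.2 hs).le, mul_assoc]
      refine mul_le_mul_of_nonneg_left ?_ (inv_pos.2 hs).le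
      calc ‖K' z‖ * ‖innB E z‖ ≤ (s⁻¹ * (K z * ‖z‖)) * ‖z‖ := by
            gcongr
            · exact (norm_nonneg _).trans (nK' z)
            · exact nK' z
            · exact innB_norm' z
        _ = s⁻¹ * (K z * ‖z‖ ^ 2) := by ring
        _ ≤ _ := mul_le_mul_of_nonneg_left (bK2 z) (inv_pos.2 hs).le

theorem main_generic [MeasureSpace E] [BorelSpace E] [SecondCountableTopology E]
    [NeZero (volume : Measure E)] (hPL : PLprop E) (V : E → ℝ) (hV : TwiceDiff V)
    (hconv : ∀ x u, 0 ≤ hessian V x u u) (w : E → ℝ) (hw : Integrable w) (Z c s a : ℝ) (hZ : 0 < Z)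
    (hc : 0 < c) (hs : 0 < s) (hwV : ∀ y, w y = Real.exp (-V y) / Z)
    (P : E → ℝ) (hP : ∀ x, P x = ∫ y, w y * gaussE c s (x - a • y)) :
    (∀ x, 0 < P x) ∧ TwiceDiff (fun x => Real.log (P x)) ∧
      ∀ x, ‖hessian (fun x => Real.log (P x)) x‖ ≤ s⁻¹ := by
  obtain ⟨K', K'', C, C', C'', hK, hK', hK''c, hC, hC', hC''⟩ := gauss_facts (E := E) c s hc hs
  have K'c : Continuous K' := continuous_iff_continuousAt.2 fun z => (hK' z).continuousAt
  have D1 := conv_deriv w hw a _ K' hK K'c C C' hC hC'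
  have D2 := conv_deriv w hw a K' K'' hK' hK''c C' C'' hC' hC''
  have hPf : P = fun x => ∫ y, w y • gaussE c s (x - a • y) := funext hP
  set P' : E → E →L[ℝ] ℝ := fun x => ∫ y, w y • K' (x - a • y)
  have dP : ∀ x, HasFDerivAt P (P' x) x := fun x => by rw [hPf]; exact (D1 x).2
  have dP' : ∀ x, DifferentiableAt ℝ P' x := fun x => (D2 x).2.differentiableAt
  -- exponential form of the integrand
  set κ := Real.log c - Real.log Z with hκ
  set Φ : E → E → ℝ := fun x y => -V y - ‖x - a • y‖ ^ 2 / (2 * s) + κ with hΦ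
  have hF : ∀ x y, w y * gaussE c s (x - a • y) = Real.exp (Φ x y) := by
    intro x y
    rw [hwV, hΦ, gaussE]
    simp only
    rw [hκ, Real.exp_add, Real.exp_sub, Real.exp_sub, Real.exp_log hc, Real.exp_log hZ, neg_div,
      Real.exp_neg (‖x - a • y‖ ^ 2 / (2 * s))]
    ring
  have hI : ∀ x, Integrable (fun y => Real.exp (Φ x y)) := fun x => by
    have := (D1 x).1
    simp only [smul_eq_mul, hF] at this
    exact this
  have hPe : ∀ x, P x = ∫ y, Real.exp (Φ x y) := fun x => by
    rw [hP x]; simp only [hF]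
  have hpos : ∀ x, 0 < P x := by
    intro x
    rw [hPe x, integral_pos_iff_support_of_nonneg (fun y => (Real.exp_pos _).le) (hI x)]
    have : Function.support (fun y => Real.exp (Φ x y)) = univ := by
      ext y; simp [(Real.exp_pos _).ne']
    rw [this]
    exact (Measure.measure_univ_pos).2 (NeZero.ne _)
  have dL : ∀ x, HasFDerivAt (fun x => Real.log (P x)) ((P x)⁻¹ • P' x) x := fun x =>
    (dP x).log (hpos x).ne'
  have hT : TwiceDiff (fun x => Real.log (P x)) := by
    refine ⟨fun x => (dL x).differentiableAt, ?_⟩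
    have : fderiv ℝ (fun x => Real.log (P x)) = fun x => (P x)⁻¹ • P' x :=
      funext fun x => (dL x).fderiv
    rw [this]
    intro x
    exact ((dP x).differentiableAt.inv (hpos x).ne').smul (dP' x)
  refine ⟨hpos, hT, fun x => ?_⟩
  have Vmeas : Continuous V := hV.1.continuous
  have Φm : ∀ x, Measurable fun y => ENNReal.ofReal (Real.exp (Φ x y)) := fun x => by
    have : Continuous fun y => Real.exp (Φ x y) := by
      simp only [hΦ]; fun_prop
    exact this.measurable.ennreal_ofReal
  have hofReal : ∀ x, ∫⁻ y, ENNReal.ofReal (Real.exp (Φ x y)) = ENNReal.ofReal (P x) := fun x => by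
    rw [hPe x, ofReal_integral_eq_lintegral_ofReal (hI x) (ae_of_all _ fun y => (Real.exp_pos _).le)]
  -- log-concavity
  have hconc : ∀ u, Real.log (P (x + u)) + Real.log (P (x - u)) ≤ 2 * Real.log (P x) := by
    intro u
    have := hPL _ _ _ (Φm (x + u)) (Φm (x - u)) (Φm x) (fun y z => by
      rw [← ENNReal.ofReal_mul (Real.exp_pos _).le, ← ENNReal.ofReal_pow (Real.exp_pos _).le,
        ← Real.exp_add, ← Real.exp_nat_mul]
      apply ENNReal.ofReal_le_ofReal
      apply Real.exp_le_exp.2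
      have h1 := mid_convex V hV hconv ((2:ℝ)⁻¹ • (y + z)) ((2:ℝ)⁻¹ • (y - z))
      have e1 : (2:ℝ)⁻¹ • (y + z) + (2:ℝ)⁻¹ • (y - z) = y := by module
      have e2 : (2:ℝ)⁻¹ • (y + z) - (2:ℝ)⁻¹ • (y - z) = z := by module
      rw [e1, e2] at h1
      set α := x + u - a • y
      set β := x - u - a • z
      have e3 : x - a • (2:ℝ)⁻¹ • (y + z) = (2:ℝ)⁻¹ • (α + β) := by
        simp only [α, β]; module
      have h2 : 2 * ‖(2:ℝ)⁻¹ • (α + β)‖ ^ 2 ≤ ‖α‖ ^ 2 + ‖β‖ ^ 2 := by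
        rw [norm_smul, mul_pow]
        have := parallelogram_law_with_norm ℝ α β
        norm_num
        nlinarith [sq_nonneg ‖α - β‖]
      have h3 : 2 * (‖(2:ℝ)⁻¹ • (α + β)‖ ^ 2 / (2 * s)) ≤ ‖α‖ ^ 2 / (2 * s) + ‖β‖ ^ 2 / (2 * s) := by
        rw [← add_div, ← mul_div_assoc]
        gcongr
      simp only [hΦ]
      rw [e3]
      push_cast
      linarith)
    rw [hofReal, hofReal, hofReal, ← ENNReal.ofReal_mul (hpos _).le,
      ← ENNReal.ofReal_pow (hpos _).le, ENNReal.ofReal_le_ofReal_iff (by positivity)] at this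
    rw [← Real.log_mul (hpos _).ne' (hpos _).ne']
    have h2 := Real.log_le_log (mul_pos (hpos _) (hpos _)) this
    rw [Real.log_pow] at h2
    exact_mod_cast h2
  -- semi-convexity
  have hsemi : ∀ u, 2 * Real.log (P x) ≤ Real.log (P (x + u)) + Real.log (P (x - u))
      + s⁻¹ * ‖u‖ ^ 2 := by
    intro u
    set A := Real.log (P (x + u)) with hA
    set B := Real.log (P (x - u)) with hB
    set q := -((A + B) / 2 + ‖u‖ ^ 2 / (2 * s)) with hq
    have eA : Real.exp (-A) * P (x + u) = 1 := by
      rw [Real.exp_neg, hA, Real.exp_log (hpos _)]; exact inv_mul_cancel₀ (hpos _).ne'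
    have eB : Real.exp (-B) * P (x - u) = 1 := by
      rw [Real.exp_neg, hB, Real.exp_log (hpos _)]; exact inv_mul_cancel₀ (hpos _).ne'
    have h1 : ∫ y, Real.exp q * Real.exp (Φ x y) ≤
        ∫ y, ((1/2) * (Real.exp (-A) * Real.exp (Φ (x + u) y)) +
          (1/2) * (Real.exp (-B) * Real.exp (Φ (x - u) y))) := by
      apply integral_mono ((hI x).const_mul _)
        ((((hI _).const_mul _).const_mul _).add (((hI _).const_mul _).const_mul _))
      intro y
      dsimp only [Pi.add_apply]
      rw [← Real.exp_add, ← Real.exp_add, ← Real.exp_add]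
      have hx := convexOn_exp.2 (mem_univ (-A + Φ (x + u) y)) (mem_univ (-B + Φ (x - u) y))
        (show (0:ℝ) ≤ 1/2 by norm_num) (show (0:ℝ) ≤ 1/2 by norm_num) (by norm_num)
      simp only [smul_eq_mul] at hx
      refine le_trans (le_of_eq ?_) hx
      congr 1
      have e3 : x + u - a • y = (x - a • y) + u := by abel
      have e4 : x - u - a • y = (x - a • y) - u := by abel
      have := parallelogram_law_with_norm ℝ (x - a • y) u
      simp only [hΦ, hq, e3, e4]
      have h5 : ‖x - a • y + u‖ ^ 2 = 2 * (‖x - a • y‖ ^ 2 + ‖u‖ ^ 2) - ‖x - a • y - u‖ ^ 2 := by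
        nlinarith
      rw [h5]
      field_simp
      ring
    rw [integral_add (((hI _).const_mul _).const_mul _) (((hI _).const_mul _).const_mul _),
      integral_const_mul, integral_const_mul, integral_const_mul, integral_const_mul,
      integral_const_mul, ← hPe, ← hPe, ← hPe, eA, eB] at h1
    have h2 := Real.log_le_log (mul_pos (Real.exp_pos q) (hpos x)) h1
    rw [Real.log_mul (Real.exp_pos q).ne' (hpos x).ne', Real.log_exp] at h2
    norm_num at h2
    have : s⁻¹ * ‖u‖ ^ 2 = 2 * (‖u‖ ^ 2 / (2 * s)) := by field_simp
    rw [this]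
    linarith
  apply hess_norm _ hT x _ (by positivity)
  · intro u
    have hn : TwiceDiff (fun x => - Real.log (P x)) := by
      refine ⟨hT.1.neg, ?_⟩
      have : fderiv ℝ (fun x => - Real.log (P x)) = fun x => - fderiv ℝ (fun x => Real.log (P x)) x :=
        funext fun x => fderiv_fun_neg
      rw [this]
      exact hT.2.neg
    have := hess_lower _ hn 0 x u (fun u => by linarith [hconc u])
    have e : hessian (fun x => - Real.log (P x)) x = - hessian (fun x => Real.log (P x)) x := by
      unfold hessian
      have : fderiv ℝ (fun x => - Real.log (P x)) = fun x => - fderiv ℝ (fun x => Real.log (P x)) x :=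
        funext fun x => fderiv_fun_neg
      rw [this]
      exact fderiv_fun_neg
    rw [e] at this
    simp at this
    exact this
  · intro u
    exact hess_lower _ hT s⁻¹ x u hsemi

end hesscalc

/-- Lemma (log-concave targets): for `p_H = e^{-V}/Z` with `V ∈ C²` convex, for every
`t > 0` the VP marginal is positive, `log p_t` is twice differentiable, and the operator
norm of its Hessian is bounded by `2/(1-e^{-t})`. -/
theorem stmt_5 (n : ℕ) (V : EuclideanSpace ℝ (Fin n) → ℝ)
    (hV : ContDiff ℝ 2 V)
    (hconv : ∀ x u, 0 ≤ fderiv ℝ (fderiv ℝ V) x u u)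
    (hVint : Integrable fun x => Real.exp (-V x))
    (Z : ℝ) (hZ : Z = ∫ x, Real.exp (-V x)) (hZpos : 0 < Z)
    (pH : EuclideanSpace ℝ (Fin n) → ℝ)
    (hpH : ∀ x, pH x = Real.exp (-V x) / Z) :
    ∀ t > (0 : ℝ),
      (∀ x, 0 < vpMarginal n pH t x) ∧
      TwiceDiff (fun x => Real.log (vpMarginal n pH t x)) ∧
      ∀ x, ‖hessian (fun z => Real.log (vpMarginal n pH t z)) x‖ ≤
        2 / (1 - Real.exp (-t)) := by
  intro t ht
  have hs : 0 < 1 - Real.exp (-t) := by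
    have : Real.exp (-t) < 1 := Real.exp_lt_one_iff.2 (by linarith)
    linarith
  have hw : Integrable pH := by
    have : pH = fun x => Real.exp (-V x) / Z := funext hpH
    rw [this]; exact hVint.div_const Z
  have hVT : TwiceDiff V := by
    refine ⟨hV.differentiable (by norm_num), ?_⟩
    exact (hV.fderiv_right (m := 1) (by norm_num)).differentiable (by norm_num)
  have hne : t ≠ 0 := ht.ne'
  have h := main_generic (PL_euclidean n) V hVT hconv pH hw Z
    ((2 * π * (1 - Real.exp (-t))) ^ (-(n : ℝ) / 2)) (1 - Real.exp (-t)) (Real.exp (-t / 2)) hZpos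
    (by positivity) hs hpH (vpMarginal n pH t) (fun x => by
      unfold vpMarginal
      rw [if_neg hne]
      rfl)
  refine ⟨h.1, h.2.1, fun x => (h.2.2 x).trans ?_⟩
  rw [inv_eq_one_div]
  gcongr
  norm_num
end
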